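/- Let X be a finite set with #X ≥ 2. The set of elements w ∈ F(X) whose stabilizer Stab(w) in Aut F(X) is infinite cyclic is exponentially F(X)-generic. -/

import Mathlib

/-! Common definitions: cyclic length, Whitehead automorphisms, the sets TS, TS', L(ε),
balls, and exponential genericity in the free group F(X). -/

/-- The cyclic length ‖w‖_X : the minimum of |g w g⁻¹|_X over g ∈ F(X). -/
noncomputable def cyclicLength {X : Type} [DecidableEq X] (w : FreeGroup X) : ℕ :=
  sInf (Set.range fun g : FreeGroup X => FreeGroup.norm (g * w * g⁻¹))

/-- w is cyclically reduced if |w|_X = ‖w‖_X. -/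
def CyclicallyReduced {X : Type} [DecidableEq X] (w : FreeGroup X) : Prop :=
  FreeGroup.norm w = cyclicLength w

/-- The set X^± = X ∪ X⁻¹ of letters, viewed inside F(X). -/
def Xpm (X : Type) : Set (FreeGroup X) :=
  (Set.range fun x : X => FreeGroup.of x) ∪ (Set.range fun x : X => (FreeGroup.of x)⁻¹)

/-- σ is a type I (relabeling) Whitehead automorphism: there is a bijection π of X^±
commuting with inversion such that σ(x) = π(x) for all x ∈ X. -/
def IsTypeI {X : Type} (σ : MulAut (FreeGroup X)) : Prop :=
  ∃ π : FreeGroup X → FreeGroup X,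
    Set.BijOn π (Xpm X) (Xpm X) ∧
    (∀ x ∈ Xpm X, π x⁻¹ = (π x)⁻¹) ∧
    (∀ x : X, σ (FreeGroup.of x) = π (FreeGroup.of x))

/-- σ is a type II Whitehead automorphism: there is a ∈ X^± with σ(a) = a and
σ(x) ∈ {x, xa, a⁻¹x, a⁻¹xa} for every x ∈ X^±. -/
def IsTypeII {X : Type} (σ : MulAut (FreeGroup X)) : Prop :=
  ∃ a ∈ Xpm X, σ a = a ∧
    ∀ x ∈ Xpm X, σ x = x ∨ σ x = x * a ∨ σ x = a⁻¹ * x ∨ σ x = a⁻¹ * x * a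

/-- σ is inner if it is conjugation by some element of F(X). -/
def IsInnerAut {X : Type} (σ : MulAut (FreeGroup X)) : Prop :=
  ∃ g : FreeGroup X, σ = MulAut.conj g

/-- w is a proper power if w = z^r for some z and some integer r ≥ 2. -/
def IsProperPower {X : Type} (w : FreeGroup X) : Prop :=
  ∃ z : FreeGroup X, ∃ r : ℕ, 2 ≤ r ∧ w = z ^ r

/-- TS is the set of cyclically reduced w that are not proper powers, whose cyclic length
is strictly increased by every non-inner type II Whitehead automorphism, and whose
conjugacy class is fixed by no non-identity type I Whitehead automorphism. -/
def TS (X : Type) [DecidableEq X] : Set (FreeGroup X) :=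
  {w | CyclicallyReduced w ∧ ¬ IsProperPower w ∧
    (∀ τ : MulAut (FreeGroup X), IsTypeII τ → ¬ IsInnerAut τ →
      cyclicLength w < cyclicLength (τ w)) ∧
    (∀ σ : MulAut (FreeGroup X), IsTypeI σ → σ ≠ 1 → ¬ IsConj w (σ w))}

/-- The set of elements of F(X) whose cyclic reduction lies in S. -/
def cyclicPreimage {X : Type} [DecidableEq X] (S : Set (FreeGroup X)) : Set (FreeGroup X) :=
  {w | ∃ g u : FreeGroup X, u ∈ S ∧ CyclicallyReduced u ∧ w = g * u * g⁻¹ ∧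
    FreeGroup.norm w = 2 * FreeGroup.norm g + FreeGroup.norm u}

/-- TS' is the set of elements of F(X) whose cyclic reduction lies in TS. -/
def TS' (X : Type) [DecidableEq X] : Set (FreeGroup X) :=
  cyclicPreimage (TS X)

/-- The ball B_n = {w ∈ F(X) : |w|_X ≤ n}. -/
def ballF (X : Type) [DecidableEq X] (n : ℕ) : Set (FreeGroup X) :=
  {w | FreeGroup.norm w ≤ n}

/-- S is exponentially T-generic: there are C > 0 and s ∈ (0,1) with
#((T∖S) ∩ B_n) ≤ C·s^n·#(T ∩ B_n) for all n. -/
def ExpGeneric {X : Type} [DecidableEq X] (S T : Set (FreeGroup X)) : Prop :=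
  ∃ C : ℝ, 0 < C ∧ ∃ s : ℝ, 0 < s ∧ s < 1 ∧
    ∀ n : ℕ, (((T \ S) ∩ ballF X n).ncard : ℝ) ≤ C * s ^ n * ((T ∩ ballF X n).ncard : ℝ)

/-- L(ε): the set of cyclically reduced w of length n ≥ 1 all of whose one-letter
frequencies lie in (1/(2N) − ε, 1/(2N) + ε) and all of whose cyclic two-letter
frequencies (for y ≠ x⁻¹) lie in (1/(2N(2N−1)) − ε, 1/(2N(2N−1)) + ε). -/
def Lset (X : Type) [Fintype X] [DecidableEq X] (ε : ℝ) : Set (FreeGroup X) :=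
  {w | CyclicallyReduced w ∧ 1 ≤ FreeGroup.norm w ∧
    ∀ x y : X × Bool, y ≠ (x.1, !x.2) →
      |((w.toWord.count x : ℝ) / (FreeGroup.norm w : ℝ)) -
        1 / (2 * (Fintype.card X : ℝ))| < ε ∧
      |(((w.toWord.zip (w.toWord.rotate 1)).count (x, y) : ℝ) / (FreeGroup.norm w : ℝ)) -
        1 / (2 * (Fintype.card X : ℝ) * (2 * (Fintype.card X : ℝ) - 1))| < ε}

namespace GenericStab

open Filter Pointwise FreeGroup

section Words

variable {X : Type}

/-- The formal inverse of a letter. -/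
def bar (a : X × Bool) : X × Bool := (a.1, !a.2)

@[simp] lemma bar_bar (a : X × Bool) : bar (bar a) = a := by simp [bar]

lemma bar_ne (a : X × Bool) : bar a ≠ a := by
  rcases a with ⟨x, b⟩
  cases b <;> simp [bar]

lemma bar_injective : Function.Injective (bar : X × Bool → X × Bool) :=
  fun a b h => by simpa using congrArg bar h

lemma bar_eq_iff {a b : X × Bool} : bar a = b ↔ a = bar b :=
  ⟨fun h => by simp [← h], fun h => by simp [h]⟩

lemma card_letters [Fintype X] : Fintype.card (X × Bool) = 2 * Fintype.card X := by
  simp [mul_comm]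

/-- The letter `a` viewed as an element of the free group. -/
def letter (a : X × Bool) : FreeGroup X := mk [a]

@[simp] lemma letter_bar (a : X × Bool) : letter (bar a) = (letter a)⁻¹ := by
  simp [letter, bar, inv_mk, invRev]

lemma isReduced_cons_cons {a b : X × Bool} {L : List (X × Bool)} :
    IsReduced (a :: b :: L) ↔ b ≠ bar a ∧ IsReduced (b :: L) := by
  have : (a.1 = b.1 → a.2 = b.2) ↔ b ≠ bar a := by
    rcases a with ⟨x, s⟩
    rcases b with ⟨y, t⟩
    cases s <;> cases t <;> simp [bar, eq_comm]
  simp [FreeGroup.IsReduced, this]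

lemma isReduced_append_iff {G U : List (X × Bool)} :
    IsReduced (G ++ U) ↔ IsReduced G ∧ IsReduced U ∧
      ∀ a ∈ G.getLast?, ∀ b ∈ U.head?, b ≠ bar a := by
  have : ∀ a b : X × Bool, (a.1 = b.1 → a.2 = b.2) ↔ b ≠ bar a := by
    rintro ⟨x, s⟩ ⟨y, t⟩
    cases s <;> cases t <;> simp [bar, eq_comm]
  simp only [FreeGroup.IsReduced, List.isChain_append, this]

/-- Two reduced words cancel in a common maximal middle piece. -/
lemma exists_cancel (G U : List (X × Bool)) (hG : IsReduced G) (hU : IsReduced U) :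
    ∃ P Q S, G = Q ++ invRev P ∧ U = P ++ S ∧ IsReduced (Q ++ S) := by
  induction G using List.reverseRecOn generalizing U with
  | nil => exact ⟨[], [], U, by simp, by simp, by simpa⟩
  | append_singleton G a ih =>
    cases U with
    | nil => exact ⟨[], G ++ [a], [], by simp, by simp, by simpa⟩
    | cons b U =>
      by_cases h : b = bar a
      · obtain ⟨P, Q, S, h1, h2, h3⟩ := ih U (hG.infix ⟨[], [a], by simp⟩)
          (hU.infix ⟨[b], [], by simp⟩)
        refine ⟨b :: P, Q, S, ?_, by simp [h2], h3⟩
        rw [invRev_cons, ← List.append_assoc, ← h1]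
        subst h
        simp [invRev, bar]
      · refine ⟨[], G ++ [a], b :: U, by simp, by simp, ?_⟩
        rw [isReduced_append_iff]
        refine ⟨hG, hU, ?_⟩
        simpa using h

lemma eventuallyEq_smul {A B : Set (FreeGroup X)} (h : A =ᶠ[cofinite] B) (g : FreeGroup X) :
    (g • A : Set (FreeGroup X)) =ᶠ[cofinite] (g • B : Set (FreeGroup X)) := by
  rw [eventuallyEq_set] at h ⊢
  have := (mul_right_injective g⁻¹).tendsto_cofinite.eventually h
  filter_upwards [this] with x hx
  simpa [Set.mem_smul_set_iff_inv_smul_mem] using hx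

lemma eventuallyLE_image {A B : Set (FreeGroup X)} (h : A ≤ᶠ[cofinite] B)
    (φ : MulAut (FreeGroup X)) : (φ '' A : Set (FreeGroup X)) ≤ᶠ[cofinite] (φ '' B : Set _) := by
  have h' : ∀ᶠ x in cofinite, x ∈ A → x ∈ B := h
  have := φ.symm.injective.tendsto_cofinite.eventually h'
  filter_upwards [this] with x hx
  rintro ⟨y, hy, rfl⟩
  exact ⟨y, by simpa [hy] using hx, rfl⟩

lemma eventuallyEq_image {A B : Set (FreeGroup X)} (h : A =ᶠ[cofinite] B)
    (φ : MulAut (FreeGroup X)) : (φ '' A : Set (FreeGroup X)) =ᶠ[cofinite] (φ '' B : Set _) :=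
  (eventuallyLE_image h.le φ).antisymm (eventuallyLE_image h.symm.le φ)

lemma image_smul_set (φ : MulAut (FreeGroup X)) (g : FreeGroup X) (A : Set (FreeGroup X)) :
    φ '' (g • A) = φ g • φ '' A := by
  ext p
  simp only [Set.mem_image, Set.mem_smul_set, smul_eq_mul]
  constructor
  · rintro ⟨_, ⟨y, hy, rfl⟩, rfl⟩
    exact ⟨_, ⟨y, hy, rfl⟩, by simp⟩
  · rintro ⟨_, ⟨y, hy, rfl⟩, rfl⟩
    exact ⟨_, ⟨y, hy, rfl⟩, by simp⟩

variable [DecidableEq X]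

lemma toWord_mk_of_isReduced {L : List (X × Bool)} (h : IsReduced L) : (mk L).toWord = L := by
  rw [toWord_mk, h.reduce_eq]

@[simp] lemma toWord_letter (a : X × Bool) : (letter a).toWord = [a] := rfl

lemma exists_cancel_mul (g u : FreeGroup X) :
    ∃ P Q S, g.toWord = Q ++ invRev P ∧ u.toWord = P ++ S ∧ (g * u).toWord = Q ++ S := by
  obtain ⟨P, Q, S, h1, h2, h3⟩ := exists_cancel g.toWord u.toWord isReduced_toWord isReduced_toWord
  refine ⟨P, Q, S, h1, h2, ?_⟩
  rw [← toWord_mk_of_isReduced h3]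
  congr 1
  calc g * u = mk g.toWord * mk u.toWord := by rw [mk_toWord, mk_toWord]
    _ = mk Q * (mk P)⁻¹ * (mk P * mk S) := by simp [h1, h2, mul_mk, inv_mk]
    _ = mk (Q ++ S) := by rw [← mul_mk]; group

lemma toWord_mul_of_ne {g u : FreeGroup X}
    (h : ∀ a ∈ g.toWord.getLast?, ∀ b ∈ u.toWord.head?, b ≠ bar a) :
    (g * u).toWord = g.toWord ++ u.toWord := by
  have : IsReduced (g.toWord ++ u.toWord) :=
    isReduced_append_iff.2 ⟨isReduced_toWord, isReduced_toWord, h⟩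
  rw [toWord_mul, this.reduce_eq]

/-- The first letter of the reduced word. -/
def hd (g : FreeGroup X) : Option (X × Bool) := g.toWord.head?

@[simp] lemma hd_one : hd (1 : FreeGroup X) = none := by simp [hd]

@[simp] lemma hd_letter (a : X × Bool) : hd (letter a) = some a := by simp [hd]

lemma hd_eq_none {g : FreeGroup X} : hd g = none ↔ g = 1 := by simp [hd]

lemma toWord_letter_mul {a : X × Bool} {g : FreeGroup X} (h : hd g ≠ some (bar a)) :
    (letter a * g).toWord = a :: g.toWord := by
  rw [toWord_mul_of_ne]
  · simp
  · simp only [toWord_letter, List.getLast?_singleton, Option.mem_def, Option.some.injEq,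
      forall_eq']
    rintro b hb rfl
    exact h hb

lemma hd_letter_mul {a : X × Bool} {g : FreeGroup X} :
    hd (letter a * g) = some a ↔ hd g ≠ some (bar a) := by
  refine ⟨fun h h' => ?_, fun h => by simp [hd, toWord_letter_mul h]⟩
  have hk : hd (letter (bar a) * (letter a * g)) = some (bar a) := by simpa using h'
  have h2 : (letter (bar a) * (letter a * g)).toWord = g.toWord := by simp
  obtain ⟨L, hL⟩ : ∃ L, g.toWord = bar a :: L := by
    rw [hd] at h'
    cases hg : g.toWord with
    | nil => simp [hg] at h'
    | cons b L => simp [hg] at h'; exact ⟨L, by rw [h']⟩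
  have hred : IsReduced (bar a :: L) := hL ▸ isReduced_toWord
  have h3 : letter a * g = mk L := by
    calc letter a * g = letter a * mk (bar a :: L) := by rw [← hL, mk_toWord]
      _ = letter a * (letter (bar a) * mk L) := by rw [letter, letter, mul_mk]; rfl
      _ = mk L := by simp
  rw [h3, hd, toWord_mk_of_isReduced (hred.infix ⟨[bar a], [], by simp⟩)] at h
  cases L with
  | nil => simp at h
  | cons b L =>
    simp at h
    subst h
    exact (isReduced_cons_cons.1 hred).1 (by simp)

lemma exists_letter_mul_of_hd {a : X × Bool} {g : FreeGroup X} (h : hd g = some a) :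
    ∃ z, g = letter a * z ∧ g.toWord = a :: z.toWord := by
  refine ⟨(letter a)⁻¹ * g, by simp, ?_⟩
  have h1 : hd ((letter a)⁻¹ * g) ≠ some (bar a) := by
    rw [← letter_bar]
    intro h'
    rw [hd_letter_mul] at h'
    simp [h] at h'
  have := toWord_letter_mul h1
  simpa using this

/-- Multiplying on the right can enter the set of words beginning with `a` only along the edge
from `1` to `a`. -/
lemma eq_of_hd_mul_letter {a x : X × Bool} {p : FreeGroup X} (h : hd p ≠ some a)
    (h' : hd (p * letter x) = some a) : p = 1 ∧ x = a := by
  obtain ⟨P, Q, S, h1, h2, h3⟩ := exists_cancel_mul p (letter x)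
  rw [hd, h1] at h
  rw [hd, h3] at h'
  cases Q with
  | cons b Q => simp_all
  | nil =>
    simp at h'
    cases P with
    | nil =>
      simp at h1 h2
      rw [← h2] at h'
      simpa [h1] using h'
    | cons b P =>
      have := congrArg List.length h2
      simp at this
      simp [this] at h'

/-- The half-space `g H_a` of the Cayley tree, where `H_a` is the set of words beginning
with `a`. -/
def halfSpace (g : FreeGroup X) (a : X × Bool) : Set (FreeGroup X) :=
  {p | hd (g⁻¹ * p) = some a}

lemma mem_halfSpace {g p : FreeGroup X} {a : X × Bool} :
    p ∈ halfSpace g a ↔ hd (g⁻¹ * p) = some a := Iff.rfl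

lemma mem_halfSpace_one {p : FreeGroup X} {a : X × Bool} :
    p ∈ halfSpace 1 a ↔ hd p = some a := by simp [halfSpace]

lemma smul_halfSpace (k g : FreeGroup X) (a : X × Bool) :
    k • halfSpace g a = halfSpace (k * g) a := by
  ext p
  simp [Set.mem_smul_set_iff_inv_smul_mem, mem_halfSpace, mul_assoc]

lemma not_mem_halfSpace_self (g : FreeGroup X) (a : X × Bool) : g ∉ halfSpace g a := by
  simp [mem_halfSpace]

lemma mul_letter_mem_halfSpace (g : FreeGroup X) (a : X × Bool) :
    g * letter a ∈ halfSpace g a := by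
  simp [mem_halfSpace]

lemma compl_halfSpace (g : FreeGroup X) (a : X × Bool) :
    (halfSpace g a)ᶜ = halfSpace (g * letter a) (bar a) := by
  ext p
  have := @hd_letter_mul X _ (bar a) (g⁻¹ * p)
  simp only [bar_bar, letter_bar] at this
  simp [mem_halfSpace, mul_assoc, this]

lemma eq_of_cross {g p : FreeGroup X} {a x : X × Bool} (h : p ∉ halfSpace g a)
    (h' : p * letter x ∈ halfSpace g a) : p = g ∧ x = a := by
  rw [mem_halfSpace] at h h'
  rw [← mul_assoc] at h'
  have := eq_of_hd_mul_letter h h'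
  exact ⟨by simpa [inv_mul_eq_one, eq_comm] using this.1, this.2⟩

lemma halfSpace_inj {g k : FreeGroup X} {a b : X × Bool} (h : halfSpace g a = halfSpace k b) :
    g = k ∧ a = b :=
  eq_of_cross (h ▸ not_mem_halfSpace_self g a) (h ▸ mul_letter_mem_halfSpace g a)

lemma mul_mem_halfSpace {g p z : FreeGroup X} {a : X × Bool} (hp : p ∈ halfSpace g a)
    (h : ∀ c ∈ (g⁻¹ * p).toWord.getLast?, ∀ b ∈ z.toWord.head?, b ≠ bar c) :
    p * z ∈ halfSpace g a := by
  rw [mem_halfSpace, ← mul_assoc, hd, toWord_mul_of_ne h]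
  rw [mem_halfSpace, hd] at hp
  simp [hp]

lemma toWord_letter_pow (a : X × Bool) (n : ℕ) : (letter a ^ n).toWord = List.replicate n a := by
  rw [letter, pow_mk, toWord_mk_of_isReduced]
  · simp
  · have := (IsCyclicallyReduced.singleton (x := a)).flatten_replicate n
    exact this.isReduced

lemma letter_pow_injective (a : X × Bool) : Function.Injective fun n : ℕ => letter a ^ n := by
  intro m n h
  have := congrArg (fun g => g.toWord.length) h
  simpa [toWord_letter_pow] using this

variable [Fintype X]

lemma exists_letter_ne (hX : 2 ≤ Fintype.card X) (s : Finset (X × Bool)) (hs : s.card ≤ 3) :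
    ∃ a, a ∉ s := by
  by_contra! h
  have : (Finset.univ : Finset (X × Bool)).card ≤ s.card :=
    Finset.card_le_card fun a _ => h a
  rw [Finset.card_univ, card_letters] at this
  omega

lemma infinite_inter_halfSpace (hX : 2 ≤ Fintype.card X) {g k p : FreeGroup X} {a b : X × Bool}
    (hp : p ∈ halfSpace g a) (hp' : p ∈ halfSpace k b) :
    (halfSpace g a ∩ halfSpace k b).Infinite := by
  have aux : ∀ u : FreeGroup X, ∃ s : Finset (X × Bool), s.card ≤ 1 ∧
      ∀ z ∉ s, ∀ c ∈ u.toWord.getLast?, z ≠ bar c := by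
    intro u
    cases h : u.toWord.getLast? with
    | none => exact ⟨∅, by simp⟩
    | some c => exact ⟨{bar c}, by simp⟩
  obtain ⟨s, hs, hs'⟩ := aux (g⁻¹ * p)
  obtain ⟨t, ht, ht'⟩ := aux (k⁻¹ * p)
  obtain ⟨z, hz⟩ := exists_letter_ne hX (s ∪ t) ((Finset.card_union_le _ _).trans (by omega))
  rw [Finset.mem_union, not_or] at hz
  refine Set.infinite_of_injective_forall_mem (f := fun n : ℕ => p * letter z ^ n)
    (fun m n h => letter_pow_injective z (mul_left_cancel h)) fun n => ?_
  have hh : ∀ b ∈ (letter z ^ n).toWord.head?, b = z := by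
    rw [toWord_letter_pow]
    cases n <;> simp [List.replicate_succ]
  refine ⟨mul_mem_halfSpace hp fun c hc b hb => ?_, mul_mem_halfSpace hp' fun c hc b hb => ?_⟩
  · rw [hh b hb]; exact hs' z hz.1 c hc
  · rw [hh b hb]; exact ht' z hz.2 c hc

lemma infinite_halfSpace (hX : 2 ≤ Fintype.card X) (g : FreeGroup X) (a : X × Bool) :
    (halfSpace g a).Infinite := by
  simpa using infinite_inter_halfSpace hX (mul_letter_mem_halfSpace g a)
    (mul_letter_mem_halfSpace g a)

lemma halfSpace_subset_of_le (hX : 2 ≤ Fintype.card X) {g k : FreeGroup X} {a b : X × Bool}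
    (h : halfSpace g a ≤ᶠ[cofinite] halfSpace k b) : halfSpace g a ⊆ halfSpace k b := by
  intro p hp
  by_contra hn
  have hn' : p ∈ (halfSpace k b)ᶜ := hn
  rw [compl_halfSpace] at hn'
  refine infinite_inter_halfSpace hX hp hn' ?_
  rw [← compl_halfSpace]
  refine Set.Finite.subset (eventually_cofinite.1 h) ?_
  rintro q ⟨h1, h2⟩ h3
  exact h2 (h3 h1)

lemma halfSpace_eq_of_eventuallyEq (hX : 2 ≤ Fintype.card X) {g k : FreeGroup X} {a b : X × Bool}
    (h : halfSpace g a =ᶠ[cofinite] halfSpace k b) : g = k ∧ a = b :=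
  halfSpace_inj ((halfSpace_subset_of_le hX h.le).antisymm (halfSpace_subset_of_le hX h.symm.le))

end Words

section Cuts

variable {X : Type}

/-- The elements `g` such that `A` separates the two ends of the path from `g` to `g * u`. -/
def cutSet (A : Set (FreeGroup X)) (u : FreeGroup X) : Set (FreeGroup X) :=
  {g | ¬(g ∈ A ↔ g * u ∈ A)}

/-- The number of translates of the path from `1` to `u` whose ends are separated by `A`. -/
noncomputable def cut (A : Set (FreeGroup X)) (u : FreeGroup X) : ℕ := (cutSet A u).ncard

lemma mem_cutSet {A : Set (FreeGroup X)} {u g : FreeGroup X} :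
    g ∈ cutSet A u ↔ ¬(g ∈ A ↔ g * u ∈ A) := Iff.rfl

/-- `A` has finite coboundary in the Cayley graph. -/
def FiniteCut (A : Set (FreeGroup X)) : Prop := ∀ u, (cutSet A u).Finite

lemma cutSet_compl (A : Set (FreeGroup X)) (u : FreeGroup X) : cutSet Aᶜ u = cutSet A u := by
  ext g
  simp only [mem_cutSet, Set.mem_compl_iff]
  tauto

lemma cutSet_smul (k : FreeGroup X) (A : Set (FreeGroup X)) (u : FreeGroup X) :
    cutSet (k • A) u = k • cutSet A u := by
  ext g
  simp [mem_cutSet, Set.mem_smul_set_iff_inv_smul_mem, mul_assoc]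

lemma cutSet_image (φ : MulAut (FreeGroup X)) (A : Set (FreeGroup X)) (u : FreeGroup X) :
    cutSet (φ '' A) (φ u) = φ '' cutSet A u := by
  ext g
  obtain ⟨g, rfl⟩ := φ.surjective g
  rw [φ.injective.mem_set_image, mem_cutSet, mem_cutSet, ← map_mul φ g u, φ.injective.mem_set_image,
    φ.injective.mem_set_image]

lemma cut_image (φ : MulAut (FreeGroup X)) (A : Set (FreeGroup X)) (u : FreeGroup X) :
    cut (φ '' A) (φ u) = cut A u := by
  rw [cut, cut, cutSet_image, Set.ncard_image_of_injective _ φ.injective]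

lemma cut_smul (k : FreeGroup X) (A : Set (FreeGroup X)) (u : FreeGroup X) :
    cut (k • A) u = cut A u := by
  rw [cut, cut, cutSet_smul]
  exact Set.ncard_image_of_injective _ (mul_right_injective k)

lemma cut_compl (A : Set (FreeGroup X)) (u : FreeGroup X) : cut Aᶜ u = cut A u := by
  rw [cut, cut, cutSet_compl]

lemma cutSet_mul_subset (A : Set (FreeGroup X)) (u v : FreeGroup X) :
    cutSet A (u * v) ⊆ cutSet A u ∪ (fun g => g * u) ⁻¹' cutSet A v := by
  intro g
  simp only [mem_cutSet, Set.mem_union, Set.mem_preimage, ← mul_assoc]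
  tauto

lemma finiteCut_of_letter {A : Set (FreeGroup X)} (h : ∀ x, (cutSet A (letter x)).Finite) :
    FiniteCut A := by
  suffices H : ∀ L : List (X × Bool), (cutSet A (mk L)).Finite by
    intro u
    induction u using Quot.inductionOn with
    | h L => exact H L
  intro L
  induction L with
  | nil =>
    convert Set.finite_empty
    ext g
    simp [mem_cutSet, ← one_eq_mk]
  | cons a L ih =>
    have : mk (a :: L) = letter a * mk L := by rw [letter, mul_mk]; rfl
    rw [this]
    refine Set.Finite.subset ((h a).union (ih.preimage ?_)) (cutSet_mul_subset _ _ _)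
    exact (mul_left_injective _).injOn

lemma FiniteCut.smul {A : Set (FreeGroup X)} (h : FiniteCut A) (k : FreeGroup X) :
    FiniteCut (k • A) := fun u => by
  rw [cutSet_smul]
  exact (h u).image _

lemma FiniteCut.compl {A : Set (FreeGroup X)} (h : FiniteCut A) : FiniteCut Aᶜ := fun u => by
  rw [cutSet_compl]
  exact h u

lemma FiniteCut.image {A : Set (FreeGroup X)} (h : FiniteCut A) (φ : MulAut (FreeGroup X)) :
    FiniteCut (φ '' A) := fun u => by
  have := cutSet_image φ A (φ.symm u)
  rw [MulEquiv.apply_symm_apply] at this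
  rw [this]
  exact (h _).image _

lemma FiniteCut.inter {A B : Set (FreeGroup X)} (h : FiniteCut A) (h' : FiniteCut B) :
    FiniteCut (A ∩ B) := fun u => by
  refine ((h u).union (h' u)).subset fun g => ?_
  simp only [mem_cutSet, Set.mem_union, Set.mem_inter_iff]
  tauto

lemma exists_cut_le {A B : Set (FreeGroup X)} (hB : FiniteCut B) (h : A =ᶠ[cofinite] B) :
    ∃ C : ℝ, ∀ u, (cut A u : ℝ) ≤ cut B u + C := by
  rw [eventuallyEq_set, eventually_cofinite] at h
  set E := {x | ¬(x ∈ A ↔ x ∈ B)} with hE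
  refine ⟨2 * E.ncard, fun u => ?_⟩
  have hpre : ((fun g => g * u) ⁻¹' E).ncard = E.ncard := by
    rw [Set.ncard_preimage_of_injective_subset_range (mul_left_injective u)]
    intro x _
    exact ⟨x * u⁻¹, by simp⟩
  have hfin : ((fun g => g * u) ⁻¹' E).Finite := h.preimage (mul_left_injective u).injOn
  have hsub : cutSet A u ⊆ cutSet B u ∪ E ∪ (fun g => g * u) ⁻¹' E := by
    intro g
    simp only [mem_cutSet, Set.mem_union, Set.mem_preimage, hE, Set.mem_ofPred_eq]
    tauto
  have h1 := Set.ncard_le_ncard hsub (((hB u).union h).union hfin)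
  have h2 := Set.ncard_union_le (cutSet B u ∪ E) ((fun g => g * u) ⁻¹' E)
  have h3 := Set.ncard_union_le (cutSet B u) E
  have : cut A u ≤ cut B u + 2 * E.ncard := by rw [cut, cut]; omega
  exact_mod_cast this

/-- The oriented coboundary edges of `A`. -/
def boundary (A : Set (FreeGroup X)) : Set (FreeGroup X × (X × Bool)) :=
  {e | e.1 ∈ cutSet A (letter e.2)}

lemma mem_boundary {A : Set (FreeGroup X)} {p : FreeGroup X} {x : X × Bool} :
    (p, x) ∈ boundary A ↔ ¬(p ∈ A ↔ p * letter x ∈ A) := Iff.rfl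

lemma boundary_compl (A : Set (FreeGroup X)) : boundary Aᶜ = boundary A := by
  ext e
  simp [boundary, cutSet_compl]

lemma ncard_boundary_smul (k : FreeGroup X) (A : Set (FreeGroup X)) :
    (boundary (k • A)).ncard = (boundary A).ncard := by
  have : boundary (k • A) = (Equiv.prodCongr (Equiv.mulLeft k) (Equiv.refl (X × Bool))) ''
      boundary A := by
    ext ⟨p, x⟩
    rw [Equiv.image_eq_preimage_symm]
    simp [boundary, cutSet_smul, Set.mem_smul_set_iff_inv_smul_mem]
  rw [this, Set.ncard_image_of_injective _ (Equiv.injective _)]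

lemma finite_boundary [Finite X] {A : Set (FreeGroup X)} (h : FiniteCut A) :
    (boundary A).Finite := by
  refine (Set.finite_iUnion fun x : X × Bool => (h (letter x)).image fun p => (p, x)).subset ?_
  rintro ⟨p, x⟩ hp
  exact Set.mem_iUnion.2 ⟨x, p, hp, rfl⟩

lemma eq_empty_or_univ_of_boundary {A : Set (FreeGroup X)} (h : boundary A = ∅) :
    A = ∅ ∨ A = Set.univ := by
  have h0 : ∀ p x, p ∈ A ↔ p * letter x ∈ A := fun p x => by
    by_contra hn
    have : (p, x) ∈ boundary A := hn
    simp [h] at this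
  have key : ∀ L : List (X × Bool), mk L ∈ A ↔ 1 ∈ A := by
    intro L
    induction L using List.reverseRecOn with
    | nil => rw [one_eq_mk]
    | append_singleton L a ih => rw [← ih, ← mul_mk, h0 (mk L) a]; rfl
  have key' : ∀ u, u ∈ A ↔ 1 ∈ A := fun u => by
    induction u using Quot.inductionOn with
    | h L => exact key L
  by_cases h1 : 1 ∈ A
  · right; ext u; simp [key' u, h1]
  · left; ext u; simp [key' u, h1]

variable [DecidableEq X]

lemma cutSet_halfSpace_letter (g : FreeGroup X) (a x : X × Bool) :
    cutSet (halfSpace g a) (letter x) ⊆ {g, g * letter a} := by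
  intro p hp
  rw [mem_cutSet] at hp
  by_cases h : p ∈ halfSpace g a
  · have h2 : p * letter x ∉ halfSpace g a := by tauto
    have h3 : p ∉ (halfSpace g a)ᶜ := by simpa
    have h4 : p * letter x ∈ (halfSpace g a)ᶜ := h2
    rw [compl_halfSpace] at h3 h4
    right
    exact (eq_of_cross h3 h4).1
  · left
    have h2 : p * letter x ∈ halfSpace g a := by tauto
    exact (eq_of_cross h h2).1

lemma finiteCut_halfSpace (g : FreeGroup X) (a : X × Bool) : FiniteCut (halfSpace g a) :=
  finiteCut_of_letter fun x =>
    (Set.toFinite {g, g * letter a}).subset (cutSet_halfSpace_letter g a x)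

/-- The elements `g` such that the path from `g` to `g * u` passes through `1`, joining a branch
in `I` with a branch in `J`. -/
def crossing (u : FreeGroup X) (I J : Finset (X × Bool)) : Set (FreeGroup X) :=
  {g | ∃ i ∈ I, ∃ j ∈ J, hd g = some i ∧ hd (g * u) = some j ∨ hd g = some j ∧ hd (g * u) = some i}

/-- The number of times the unoriented turn `{i, j}` is taken along `u`. -/
noncomputable def turn (u : FreeGroup X) (i j : X × Bool) : ℕ := (crossing u {i} {j}).ncard

lemma crossing_subset_cutSet (u : FreeGroup X) {i j : X × Bool} (h : i ≠ j) :
    crossing u {i} {j} ⊆ cutSet (halfSpace 1 i) u := by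
  rintro g ⟨i', hi', j', hj', hg⟩
  rw [Finset.mem_singleton] at hi' hj'
  subst hi' hj'
  rw [mem_cutSet, mem_halfSpace_one, mem_halfSpace_one]
  rcases hg with ⟨h1, h2⟩ | ⟨h1, h2⟩ <;> simp [h1, h2, h.symm]

lemma crossing_eq_biUnion (u : FreeGroup X) (I J : Finset (X × Bool)) :
    crossing u I J = ⋃ e ∈ I ×ˢ J, crossing u {e.1} {e.2} := by
  ext g
  simp only [crossing, Finset.mem_singleton, Set.mem_iUnion, Finset.mem_product]
  constructor
  · rintro ⟨i, hi, j, hj, hg⟩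
    exact ⟨(i, j), ⟨hi, hj⟩, i, rfl, j, rfl, hg⟩
  · rintro ⟨⟨i, j⟩, ⟨hi, hj⟩, i', hi', j', hj', hg⟩
    subst hi' hj'
    exact ⟨_, hi, _, hj, hg⟩

lemma finite_crossing (u : FreeGroup X) {I J : Finset (X × Bool)} (h : Disjoint I J) :
    (crossing u I J).Finite := by
  rw [crossing_eq_biUnion]
  refine Set.Finite.biUnion (Finset.finite_toSet _) fun e he => ?_
  rw [SetLike.mem_coe, Finset.mem_product] at he
  exact (finiteCut_halfSpace 1 e.1 u).subset
    (crossing_subset_cutSet u (Finset.disjoint_iff_ne.1 h _ he.1 _ he.2))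

lemma ncard_crossing (u : FreeGroup X) {I J : Finset (X × Bool)} (h : Disjoint I J) :
    (crossing u I J).ncard = ∑ e ∈ I ×ˢ J, turn u e.1 e.2 := by
  have hfin : ∀ e ∈ I ×ˢ J, (crossing u {e.1} {e.2}).Finite := fun e he => by
    rw [Finset.mem_product] at he
    exact finite_crossing u (by simpa using Finset.disjoint_iff_ne.1 h _ he.1 _ he.2)
  have hun : crossing u I J = ⋃ e ∈ ((I ×ˢ J : Finset _) : Set ((X × Bool) × (X × Bool))), crossing u {e.1} {e.2} :=
    crossing_eq_biUnion u I J
  rw [hun, Set.Finite.ncard_biUnion (Finset.finite_toSet _) hfin]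
  · rw [finsum_mem_coe_finset]
    rfl
  · rintro ⟨i, j⟩ he ⟨i', j'⟩ he' hne
    simp only [Finset.coe_product, Set.mem_prod, SetLike.mem_coe] at he he'
    refine Set.disjoint_left.2 ?_
    rintro g ⟨_, h1, _, h2, hg⟩ ⟨_, h1', _, h2', hg'⟩
    simp only [Finset.mem_singleton] at h1 h2 h1' h2'
    subst h1 h2 h1' h2'
    have n1 := Finset.disjoint_iff_ne.1 h _ he.1 _ he'.2
    have n2 := Finset.disjoint_iff_ne.1 h _ he'.1 _ he.2
    rcases hg with ⟨a1, a2⟩ | ⟨a1, a2⟩ <;> rcases hg' with ⟨b1, b2⟩ | ⟨b1, b2⟩ <;>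
      rw [a1] at b1 <;> rw [a2] at b2 <;> simp_all

lemma le_ncard_crossing {u : FreeGroup X} {lo : ℝ} {I J : Finset (X × Bool)} (h : Disjoint I J)
    (hlo : ∀ i j, i ≠ j → lo ≤ turn u i j) :
    (I.card * J.card : ℝ) * lo ≤ (crossing u I J).ncard := by
  rw [ncard_crossing u h, Nat.cast_sum]
  have := Finset.card_nsmul_le_sum (I ×ˢ J) (fun e => (turn u e.1 e.2 : ℝ)) lo fun e he =>
    hlo _ _ (Finset.disjoint_iff_ne.1 h _ (Finset.mem_product.1 he).1 _ (Finset.mem_product.1 he).2)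
  simpa [Finset.card_product] using this

lemma ncard_crossing_le {u : FreeGroup X} {hi : ℝ} {I J : Finset (X × Bool)} (h : Disjoint I J)
    (hhi : ∀ i j, i ≠ j → turn u i j ≤ hi) :
    (crossing u I J).ncard ≤ (I.card * J.card : ℝ) * hi := by
  rw [ncard_crossing u h, Nat.cast_sum]
  have := Finset.sum_le_card_nsmul (I ×ˢ J) (fun e => (turn u e.1 e.2 : ℝ)) hi fun e he =>
    hhi _ _ (Finset.disjoint_iff_ne.1 h _ (Finset.mem_product.1 he).1 _ (Finset.mem_product.1 he).2)
  simpa [Finset.card_product] using this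

lemma hd_cases (g : FreeGroup X) : g = 1 ∨ ∃ a, hd g = some a := by
  cases h : hd g with
  | none => exact Or.inl (hd_eq_none.1 h)
  | some a => exact Or.inr ⟨a, rfl⟩

variable [Fintype X]

lemma le_cut_halfSpace {u : FreeGroup X} {lo : ℝ} (hlo : ∀ i j, i ≠ j → lo ≤ turn u i j)
    (g : FreeGroup X) (a : X × Bool) :
    (2 * Fintype.card X - 1 : ℝ) * lo ≤ cut (halfSpace g a) u := by
  have h1 : cut (halfSpace g a) u = cut (halfSpace 1 a) u := by
    rw [← cut_smul g (halfSpace 1 a), smul_halfSpace, mul_one]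
  have hdis : Disjoint {a} (Finset.univ.erase a) := by simp
  have h2 := le_ncard_crossing hdis hlo
  have h3 : crossing u {a} (Finset.univ.erase a) ⊆ cutSet (halfSpace 1 a) u := by
    rintro g ⟨i, hi, j, hj, hg⟩
    rw [Finset.mem_singleton] at hi
    rw [Finset.mem_erase] at hj
    rw [mem_cutSet, mem_halfSpace_one, mem_halfSpace_one]
    rcases hg with ⟨h1, h2⟩ | ⟨h1, h2⟩ <;> simp [h1, h2, hi, hj.1]
  have h4 := Set.ncard_le_ncard h3 (finiteCut_halfSpace 1 a u)
  have h5 : (((Finset.univ.erase a).card : ℕ) : ℝ) = 2 * Fintype.card X - 1 := by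
    rw [Finset.card_erase_of_mem (Finset.mem_univ _), Finset.card_univ, card_letters,
      Nat.cast_sub (by have := Fintype.card_pos_iff.2 ⟨a.1⟩; omega)]
    simp
  rw [h5] at h2
  rw [h1]
  simp only [Finset.card_singleton, Nat.cast_one, one_mul] at h2
  exact h2.trans (by exact_mod_cast h4)

lemma cut_halfSpace_le {u : FreeGroup X} {hi : ℝ} (hhi : ∀ i j, i ≠ j → turn u i j ≤ hi)
    (g : FreeGroup X) (a : X × Bool) :
    cut (halfSpace g a) u ≤ (2 * Fintype.card X - 1 : ℝ) * hi + 2 := by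
  have h1 : cut (halfSpace g a) u = cut (halfSpace 1 a) u := by
    rw [← cut_smul g (halfSpace 1 a), smul_halfSpace, mul_one]
  have hdis : Disjoint {a} (Finset.univ.erase a) := by simp
  have h2 := ncard_crossing_le hdis hhi
  have h3 : cutSet (halfSpace 1 a) u ⊆ crossing u {a} (Finset.univ.erase a) ∪ {1, u⁻¹} := by
    intro g hg
    rw [mem_cutSet, mem_halfSpace_one, mem_halfSpace_one] at hg
    by_cases h : g ∈ ({1, u⁻¹} : Set (FreeGroup X))
    · exact Or.inr h
    left
    rw [Set.mem_insert_iff, Set.mem_singleton_iff, not_or] at h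
    rcases hd_cases g with h' | ⟨b, hb⟩
    · exact absurd h' h.1
    rcases hd_cases (g * u) with h' | ⟨c, hc⟩
    · exact absurd (eq_inv_of_mul_eq_one_left h') h.2
    rw [hb, hc] at hg
    by_cases hba : b = a
    · subst hba
      refine ⟨b, by simp, c, ?_, Or.inl ⟨hb, hc⟩⟩
      rw [Finset.mem_erase]
      exact ⟨fun h => hg (by simp [h]), Finset.mem_univ _⟩
    · have : c = a := by
        by_contra hca
        exact hg (by simp [hba, hca])
      subst this
      exact ⟨c, by simp, b, by simp [hba], Or.inr ⟨hb, hc⟩⟩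
  have h4 := Set.ncard_le_ncard h3 ((finite_crossing u hdis).union (Set.toFinite _))
  have h5 : (((Finset.univ.erase a).card : ℕ) : ℝ) = 2 * Fintype.card X - 1 := by
    rw [Finset.card_erase_of_mem (Finset.mem_univ _), Finset.card_univ, card_letters,
      Nat.cast_sub (by have := Fintype.card_pos_iff.2 ⟨a.1⟩; omega)]
    simp
  rw [h5] at h2
  rw [h1]
  simp only [Finset.card_singleton, Nat.cast_one, one_mul] at h2
  have h6 := Set.ncard_union_le (crossing u {a} (Finset.univ.erase a)) {1, u⁻¹}
  have h7 : ({1, u⁻¹} : Set (FreeGroup X)).ncard ≤ 2 := Set.ncard_insert_le _ _ |>.trans (by simp)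
  have h8 : (cut (halfSpace 1 a) u : ℝ) ≤ (crossing u {a} (Finset.univ.erase a)).ncard + 2 := by
    have : cut (halfSpace 1 a) u ≤ (crossing u {a} (Finset.univ.erase a)).ncard + 2 := by
      rw [cut]; omega
    exact_mod_cast this
  linarith

end Cuts

section Trichotomy

variable {X : Type}

lemma FiniteCut.congr {A B : Set (FreeGroup X)} (hB : FiniteCut B) (h : A =ᶠ[cofinite] B) :
    FiniteCut A := fun u => by
  rw [eventuallyEq_set, eventually_cofinite] at h
  have hfin : ((fun g => g * u) ⁻¹' {x | ¬(x ∈ A ↔ x ∈ B)}).Finite :=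
    h.preimage (mul_left_injective u).injOn
  refine (((hB u).union h).union hfin).subset fun g => ?_
  simp only [mem_cutSet, Set.mem_union, Set.mem_preimage, Set.mem_ofPred_eq]
  tauto

lemma mem_boundary_reverse {A : Set (FreeGroup X)} {p : FreeGroup X} {x : X × Bool} :
    (p * letter x, bar x) ∈ boundary A ↔ (p, x) ∈ boundary A := by
  simp only [mem_boundary, letter_bar, mul_inv_cancel_right]
  tauto

variable [DecidableEq X]

/-- Beyond an extremal coboundary edge, `A` is constant on all branches but one. -/
lemma exists_vertex_const [Finite X] {A : Set (FreeGroup X)} (h : FiniteCut A)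
    (hne : (boundary A).Nonempty) :
    ∃ v c i, i ≠ c ∧ (v, i) ∈ boundary A ∧
      ∀ j ≠ c, ∀ p ∈ halfSpace v j, (p ∈ A ↔ v * letter j ∈ A) := by
  obtain ⟨⟨v, i⟩, hmem, hmax⟩ := Set.exists_max_image (boundary A)
    (fun e => (e.1 * letter e.2).toWord.length) (finite_boundary h) hne
  have hout : ∀ a ∈ v.toWord.getLast?, i ≠ bar a := by
    rintro a ha rfl
    obtain ⟨L, hL⟩ := List.mem_getLast?_eq_getLast ha |> fun ⟨h, e⟩ =>
      (⟨v.toWord.dropLast, by rw [e]; exact (List.dropLast_append_getLast h).symm⟩ :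
        ∃ L, v.toWord = L ++ [a])
    have h1 : v * letter (bar a) = mk L := by
      rw [letter_bar, mul_inv_eq_iff_eq_mul, letter, mul_mk, ← hL, mk_toWord]
    have h2 := hmax _ (mem_boundary_reverse.2 hmem)
    have h3 : IsReduced L := (hL ▸ isReduced_toWord (x := v)).infix ⟨[], [a], by simp⟩
    simp only [bar_bar] at h2
    rw [h1, toWord_mk_of_isReduced h3, ← h1] at h2
    simp [hL] at h2
  have hlen : (v * letter i).toWord.length = v.toWord.length + 1 := by
    rw [toWord_mul_of_ne]
    · simp
    · simpa using fun a ha => hout a ha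
  obtain ⟨c, hic, hc⟩ : ∃ c, i ≠ c ∧ ∀ j ≠ c, ∀ a ∈ v.toWord.getLast?, j ≠ bar a := by
    cases hv : v.toWord.getLast? with
    | none => exact ⟨bar i, (bar_ne i).symm, by simp⟩
    | some a => exact ⟨bar a, hout a (by simp [hv]), by simp⟩
  refine ⟨v, c, i, hic, hmem, fun j hj p hp => ?_⟩
  have key : ∀ L, IsReduced (j :: L) → (v * mk (j :: L) ∈ A ↔ v * letter j ∈ A) := by
    intro L
    induction L using List.reverseRecOn with
    | nil => intro _; rfl
    | append_singleton L a ih =>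
      intro hr
      rw [← ih (hr.infix ⟨[], [a], by simp⟩)]
      have hm : v * mk (j :: (L ++ [a])) = v * mk (j :: L) * letter a := by
        rw [mul_assoc, letter, mul_mk]; rfl
      by_contra hn
      have hb : (v * mk (j :: L), a) ∈ boundary A := by
        rw [mem_boundary, ← hm]
        tauto
      have h2 := hmax _ hb
      simp only [← hm, hlen] at h2
      rw [toWord_mul_of_ne, toWord_mk_of_isReduced hr] at h2
      · simp at h2
      · rw [toWord_mk_of_isReduced hr]
        simpa using fun a ha => hc j hj a ha
  obtain ⟨z, hz, hz'⟩ := exists_letter_mul_of_hd (mem_halfSpace.1 hp)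
  have h1 : p = v * mk (j :: z.toWord) := by
    rw [← hz', mk_toWord]; simp
  rw [h1]
  exact key _ (hz' ▸ isReduced_toWord)

variable [Fintype X]

/-- The number of translates of `u` cut by `A` is large for all words `u` taking all turns about
equally often. -/
def LargeCut (A : Set (FreeGroup X)) : Prop :=
  ∃ C : ℝ, ∀ (u : FreeGroup X) (lo hi : ℝ), 0 ≤ lo → (∀ i j, i ≠ j → lo ≤ turn u i j) →
    (∀ i j, i ≠ j → turn u i j ≤ hi) → hi ≤ 2 * lo →
      (2 * Fintype.card X + 1) * lo - hi ≤ cut A u + C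

/-- The possible behaviours of a set with finite coboundary. -/
def Trichotomy (A : Set (FreeGroup X)) : Prop :=
  A =ᶠ[cofinite] (∅ : Set _) ∨ A =ᶠ[cofinite] (Set.univ : Set _) ∨
    (∃ g a, A =ᶠ[cofinite] halfSpace g a) ∨ LargeCut A

lemma Trichotomy.compl {A : Set (FreeGroup X)} (h : Trichotomy A) : Trichotomy Aᶜ := by
  rcases h with h | h | ⟨g, a, h⟩ | ⟨C, h⟩
  · exact Or.inr (Or.inl (by simpa using h.compl))
  · exact Or.inl (by simpa using h.compl)
  · exact Or.inr (Or.inr (Or.inl ⟨_, _, compl_halfSpace g a ▸ h.compl⟩))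
  · exact Or.inr (Or.inr (Or.inr ⟨C, fun u => by rw [cut_compl]; exact h u⟩))

lemma Trichotomy.smul {A : Set (FreeGroup X)} (h : Trichotomy A) (k : FreeGroup X) :
    Trichotomy (k • A) := by
  rcases h with h | h | ⟨g, a, h⟩ | ⟨C, h⟩
  · exact Or.inl (by simpa using eventuallyEq_smul h k)
  · exact Or.inr (Or.inl (by simpa using eventuallyEq_smul h k))
  · exact Or.inr (Or.inr (Or.inl ⟨_, _, smul_halfSpace k g a ▸ eventuallyEq_smul h k⟩))
  · exact Or.inr (Or.inr (Or.inr ⟨C, fun u => by rw [cut_smul]; exact h u⟩))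

lemma LargeCut.congr {A B : Set (FreeGroup X)} (hA : FiniteCut A) (hB : LargeCut B)
    (h : A =ᶠ[cofinite] B) : LargeCut A := by
  obtain ⟨C, hC⟩ := hB
  obtain ⟨D, hD⟩ := exists_cut_le hA h.symm
  refine ⟨C + D, fun u lo hi h0 h1 h2 h3 => ?_⟩
  linarith [hC u lo hi h0 h1 h2 h3, hD u]

lemma Trichotomy.congr {A B : Set (FreeGroup X)} (hA : FiniteCut A) (hB : Trichotomy B)
    (h : A =ᶠ[cofinite] B) : Trichotomy A := by
  rcases hB with h' | h' | ⟨g, a, h'⟩ | h'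
  · exact Or.inl (h.trans h')
  · exact Or.inr (Or.inl (h.trans h'))
  · exact Or.inr (Or.inr (Or.inl ⟨g, a, h.trans h'⟩))
  · exact Or.inr (Or.inr (Or.inr (h'.congr hA h)))

lemma ncard_boundary_inter_lt {A : Set (FreeGroup X)} (hA : FiniteCut A) {c i j₁ j₂ : X × Bool}
    (hic : i ≠ c) (hi : (1, i) ∈ boundary A) (hj : j₁ ≠ j₂)
    (h₁ : j₁ ≠ c ∧ letter j₁ ∉ A) (h₂ : j₂ ≠ c ∧ letter j₂ ∉ A) :
    (boundary (A ∩ halfSpace 1 c)).ncard < (boundary A).ncard := by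
  have hfin := finite_boundary hA
  have hout : ∀ p x, p ∉ halfSpace 1 c → p * letter x ∈ halfSpace 1 c → p = 1 ∧ x = c :=
    fun p x h h' => eq_of_cross h h'
  have hin : ∀ p x, p ∈ halfSpace 1 c → p * letter x ∉ halfSpace 1 c →
      p = letter c ∧ x = bar c := fun p x h h' => by
    have h3 : p ∉ (halfSpace 1 c)ᶜ := by simpa
    have h4 : p * letter x ∈ (halfSpace 1 c)ᶜ := h'
    rw [compl_halfSpace] at h3 h4
    simpa using eq_of_cross h3 h4
  have h1 : (1 : FreeGroup X) ∉ halfSpace 1 c := not_mem_halfSpace_self 1 c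
  have hl : ∀ j ≠ c, letter j ∉ halfSpace 1 c := fun j hj => by
    simpa [mem_halfSpace] using hj
  by_cases h1A : 1 ∈ A
  · set K := {e : FreeGroup X × (X × Bool) | e.1 ∈ halfSpace 1 c ∧ e.1 * letter e.2 ∈ halfSpace 1 c}
    have hs : boundary (A ∩ halfSpace 1 c) ⊆ (boundary A ∩ K) ∪ {(1, c), (letter c, bar c)} := by
      rintro ⟨p, x⟩ hp
      by_cases ha : p ∈ halfSpace 1 c <;> by_cases hb : p * letter x ∈ halfSpace 1 c
      · left
        refine ⟨?_, ha, hb⟩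
        simpa [mem_boundary, ha, hb] using hp
      · obtain ⟨rfl, rfl⟩ := hin p x ha hb
        simp
      · obtain ⟨rfl, rfl⟩ := hout p x ha hb
        simp
      · simp [mem_boundary, ha, hb] at hp
    have hs' : (boundary A ∩ K) ∪ {(1, j₁), (1, j₂), (letter j₁, bar j₁)} ⊆ boundary A := by
      rintro e (he | rfl | rfl | rfl)
      · exact he.1
      · simp [mem_boundary, h1A, h₁.2]
      · simp [mem_boundary, h1A, h₂.2]
      · simp [mem_boundary, h1A, h₁.2]
    have hd : Disjoint (boundary A ∩ K) {(1, j₁), (1, j₂), (letter j₁, bar j₁)} := by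
      refine Set.disjoint_left.2 ?_
      rintro e he (rfl | rfl | rfl)
      · exact h1 he.2.1
      · exact h1 he.2.1
      · exact hl _ h₁.1 he.2.1
    have hj1 : (1 : FreeGroup X) ≠ letter j₁ := fun h => by
      have := congrArg (fun g => g.toWord.length) h
      simp at this
    have h3 : ({(1, j₁), (1, j₂), (letter j₁, bar j₁)} :
        Set (FreeGroup X × (X × Bool))).ncard = 3 := by
      rw [Set.ncard_eq_three]
      exact ⟨_, _, _, by simp [hj], by simp [hj1], by simp [hj1], rfl⟩
    have h4 := Set.ncard_le_ncard hs' hfin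
    rw [Set.ncard_union_eq hd (hfin.inter_of_left _) (Set.toFinite _), h3] at h4
    have h5 := Set.ncard_le_ncard hs ((hfin.inter_of_left _).union (Set.toFinite _))
    have h6 := Set.ncard_union_le (boundary A ∩ K) {(1, c), (letter c, bar c)}
    have h7 : ({(1, c), (letter c, bar c)} : Set (FreeGroup X × (X × Bool))).ncard ≤ 2 :=
      Set.ncard_insert_le _ _ |>.trans (by simp)
    omega
  · refine Set.ncard_lt_ncard ⟨?_, fun h => ?_⟩ hfin
    · rintro ⟨p, x⟩ hp
      by_cases ha : p ∈ halfSpace 1 c <;> by_cases hb : p * letter x ∈ halfSpace 1 c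
      · simpa [mem_boundary, ha, hb] using hp
      · obtain ⟨rfl, rfl⟩ := hin p x ha hb
        simpa [mem_boundary, ha, h1, h1A] using hp
      · obtain ⟨rfl, rfl⟩ := hout p x ha hb
        simp only [one_mul] at hb
        simpa [mem_boundary, ha, hb, h1A] using hp
      · simp [mem_boundary, ha, hb] at hp
    · have := h hi
      simp [mem_boundary, h1, hl i hic] at this

lemma trichotomy_of_const (hX : 2 ≤ Fintype.card X) {A : Set (FreeGroup X)} (hA : FiniteCut A)
    (ih : ∀ B : Set (FreeGroup X), FiniteCut B → (boundary B).ncard < (boundary A).ncard → Trichotomy B)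
    {c i : X × Bool} (hic : i ≠ c) (hi : (1, i) ∈ boundary A)
    (hconst : ∀ j ≠ c, ∀ p ∈ halfSpace 1 j, (p ∈ A ↔ letter j ∈ A))
    {I J : Finset (X × Bool)} (hI : ∀ j, j ∈ I ↔ j ≠ c ∧ letter j ∈ A)
    (hJ : ∀ j, j ∈ J ↔ j ≠ c ∧ letter j ∉ A)
    (hIJ : I.card ≤ J.card) : Trichotomy A := by
  have hdisj : Disjoint I J := Finset.disjoint_left.2 fun j h h' => ((hJ j).1 h').2 ((hI j).1 h).2
  have hcard : I.card + J.card = 2 * Fintype.card X - 1 := by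
    rw [← Finset.card_union_of_disjoint hdisj, ← card_letters, ← Finset.card_univ,
      ← Finset.card_erase_of_mem (Finset.mem_univ c)]
    congr 1
    ext j
    simp only [Finset.mem_union, hI, hJ, Finset.mem_erase, Finset.mem_univ]
    tauto
  obtain ⟨j₁, h₁, j₂, h₂, hj⟩ := Finset.one_lt_card.1 (show 1 < J.card by omega)
  have hlt := ncard_boundary_inter_lt hA hic hi hj ((hJ _).1 h₁) ((hJ _).1 h₂)
  set A' := A ∩ halfSpace 1 c with hA'
  have hA'f : FiniteCut A' := hA.inter (finiteCut_halfSpace 1 c)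
  have hcl := ih A' hA'f hlt
  have hhd : ∀ p a, hd p = some a → (p ∈ A ↔ p ∈ A' ∨ a ∈ I) := by
    intro p a hp
    rw [hI]
    by_cases hac : a = c
    · subst hac
      simp [hA', mem_halfSpace_one, hp]
    · simp [hA', mem_halfSpace_one, hp, hac, hconst a hac p (mem_halfSpace_one.2 hp)]
  have hhd' : ∀ p a, hd p = some a → p ∈ A' → a = c := by
    intro p a hp h
    have := h.2
    rw [mem_halfSpace_one, hp] at this
    exact Option.some.inj this
  have hcI : c ∉ I := fun h => ((hI c).1 h).1 rfl
  have hcJ : c ∉ J := fun h => ((hJ c).1 h).1 rfl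
  rcases I.eq_empty_or_nonempty with hI0 | hI0
  · refine hcl.congr hA ?_
    rw [eventuallyEq_set]
    filter_upwards [(Set.finite_singleton (1 : FreeGroup X)).compl_mem_cofinite] with p hp
    rcases hd_cases p with h | ⟨a, h⟩
    · exact absurd h hp
    · simp [hhd p a h, hI0]
  set A0 := A \ {1} with hA0
  have hA0e : A0 =ᶠ[cofinite] A := by
    rw [eventuallyEq_set]
    filter_upwards [(Set.finite_singleton (1 : FreeGroup X)).compl_mem_cofinite] with p hp
    have : p ≠ 1 := hp
    simp [hA0, this]
  have hA0f : FiniteCut A0 := hA.congr hA0e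
  have hA0m : ∀ p, p ∈ A0 ↔ p ∈ A' ∨ ∃ a ∈ I, hd p = some a := by
    intro p
    rcases hd_cases p with rfl | ⟨a, h⟩
    · simp [hA0, hA', mem_halfSpace_one]
    · have : p ≠ 1 := fun h' => by simp [h'] at h
      simp [hA0, this, hhd p a h, h]
  have hA'm : ∀ p ∈ A', hd p = some c := fun p hp => mem_halfSpace_one.1 hp.2
  have hcut : ∀ u, cut A' u + (crossing u I J).ncard ≤ cut A0 u + (crossing u I {c}).ncard := by
    intro u
    have hIc : Disjoint I {c} := by simpa using hcI
    rw [cut, ← Set.ncard_union_eq _ (hA'f u) (finite_crossing u hdisj)]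
    · refine (Set.ncard_le_ncard ?_ ((hA0f u).union (finite_crossing u hIc))).trans
        (Set.ncard_union_le _ _)
      rintro g (hg | ⟨i, hi, j, hj, hg⟩)
      · by_cases hg0 : g ∈ cutSet A0 u
        · exact Or.inl hg0
        right
        rw [mem_cutSet, hA0m, hA0m] at hg0
        rw [mem_cutSet] at hg
        by_cases h1 : g ∈ A'
        · have h2 : g * u ∉ A' := by tauto
          obtain ⟨a, ha, ha'⟩ : ∃ a ∈ I, hd (g * u) = some a := by tauto
          exact ⟨a, ha, c, by simp, Or.inr ⟨hA'm _ h1, ha'⟩⟩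
        · have h2 : g * u ∈ A' := by tauto
          obtain ⟨a, ha, ha'⟩ : ∃ a ∈ I, hd g = some a := by tauto
          exact ⟨a, ha, c, by simp, Or.inl ⟨ha', hA'm _ h2⟩⟩
      · left
        rw [mem_cutSet, hA0m, hA0m]
        have hic : i ≠ c := fun h => hcI (h ▸ hi)
        have hjc : j ≠ c := fun h => hcJ (h ▸ hj)
        have hjI : j ∉ I := Finset.disjoint_right.1 hdisj hj
        rcases hg with ⟨h1, h2⟩ | ⟨h1, h2⟩
        · have h3 : g * u ∉ A' := fun h => hjc (hhd' _ _ h2 h)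
          simp [h1, h2, h3, hi, hjI]
        · have h3 : g ∉ A' := fun h => hjc (hhd' _ _ h1 h)
          simp [h1, h2, h3, hi, hjI]
    · refine Set.disjoint_left.2 ?_
      rintro g hg ⟨i, hi, j, hj, hg'⟩
      have hic : i ≠ c := fun h => hcI (h ▸ hi)
      have hjc : j ≠ c := fun h => hcJ (h ▸ hj)
      rw [mem_cutSet] at hg
      rcases hg' with ⟨h1, h2⟩ | ⟨h1, h2⟩
      · exact hg (iff_of_false (fun h => hic (hhd' _ _ h1 h)) fun h => hjc (hhd' _ _ h2 h))
      · exact hg (iff_of_false (fun h => hjc (hhd' _ _ h1 h)) fun h => hic (hhd' _ _ h2 h))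
  have hI1 : (1 : ℝ) ≤ I.card := by exact_mod_cast Finset.card_pos.2 hI0
  have hJ2 : (2 : ℝ) ≤ J.card := by exact_mod_cast (show 2 ≤ J.card by omega)
  have hXr : (2 : ℝ) ≤ Fintype.card X := by exact_mod_cast hX
  obtain ⟨D, hD⟩ := exists_cut_le hA hA0e
  have hgain : ∀ (u : FreeGroup X) (lo hi : ℝ), 0 ≤ lo → (∀ i j, i ≠ j → lo ≤ turn u i j) →
      (∀ i j, i ≠ j → turn u i j ≤ hi) → hi ≤ 2 * lo →
      (cut A' u : ℝ) + (2 * lo - hi) ≤ cut A u + D := by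
    intro u lo hi h0 hlo hhi h
    have h1 := le_ncard_crossing hdisj hlo
    have h2 := ncard_crossing_le (I := I) (J := {c}) (by simpa using hcI) hhi
    have h3 : (cut A' u + (crossing u I J).ncard : ℝ) ≤ cut A0 u + (crossing u I {c}).ncard := by
      exact_mod_cast hcut u
    have h4 := hD u
    simp only [Finset.card_singleton, Nat.cast_one, mul_one] at h2
    have h6 : 2 * lo - hi ≤ J.card * lo - hi := by
      linarith [mul_le_mul_of_nonneg_right hJ2 h0]
    have h5 : 2 * lo - hi ≤ I.card * (J.card * lo - hi) := by
      nlinarith [mul_le_mul_of_nonneg_right hI1 (show 0 ≤ J.card * lo - hi by linarith)]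
    nlinarith
  rcases hcl with h | h | ⟨g, a, h⟩ | ⟨C, hC⟩
  · set U := {p : FreeGroup X | ∃ a ∈ I, hd p = some a} with hU
    have hAU : A =ᶠ[cofinite] U := by
      refine hA0e.symm.trans ?_
      rw [eventuallyEq_set] at h ⊢
      filter_upwards [h] with p hp
      rw [hA0m, hp]
      simp [hU]
    rcases hI1.eq_or_lt with hk | hk
    · obtain ⟨a, ha⟩ := Finset.card_eq_one.1 (by exact_mod_cast hk.symm : I.card = 1)
      refine Or.inr (Or.inr (Or.inl ⟨1, a, ?_⟩))
      have : halfSpace 1 a = U := by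
        ext p
        simp [hU, ha, mem_halfSpace_one]
      rwa [this]
    · right; right; right
      obtain ⟨D', hD'⟩ := exists_cut_le hA hAU.symm
      have hUf : FiniteCut U := hA.congr hAU.symm
      refine ⟨D', fun u lo hi h0 hlo hhi _ => ?_⟩
      have hd' : Disjoint I Iᶜ := disjoint_compl_right
      have h1 := le_ncard_crossing hd' hlo
      have h2 : crossing u I Iᶜ ⊆ cutSet U u := by
        rintro g ⟨i, hi, j, hj, hg⟩
        rw [Finset.mem_compl] at hj
        have hUm : ∀ p a, hd p = some a → (p ∈ U ↔ a ∈ I) := fun p a hp => by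
          simp only [hU, Set.mem_ofPred_eq, hp, Option.some.injEq, exists_eq_right']
        rw [mem_cutSet]
        rcases hg with ⟨h1, h2⟩ | ⟨h1, h2⟩ <;> simp [hUm _ _ h1, hUm _ _ h2, hi, hj]
      have h3 : ((crossing u I Iᶜ).ncard : ℝ) ≤ cut U u := by
        exact_mod_cast Set.ncard_le_ncard h2 (hUf u)
      have h4 : ((Iᶜ.card : ℕ) : ℝ) = 2 * Fintype.card X - I.card := by
        have : Iᶜ.card + I.card = 2 * Fintype.card X := by
          rw [← card_letters, Finset.card_compl_add_card]
        rw [eq_sub_iff_add_eq]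
        exact_mod_cast this
      have h5 : (2 : ℝ) ≤ I.card := by
        exact_mod_cast (show 1 < I.card by exact_mod_cast hk)
      have h6 : (I.card : ℝ) ≤ Fintype.card X - 1 := by
        rw [le_sub_iff_add_le]
        exact_mod_cast (show I.card + 1 ≤ Fintype.card X by omega)
      have h7 : lo ≤ hi := (hlo i c hic).trans (hhi i c hic)
      have h8 : (2 * Fintype.card X : ℝ) ≤ I.card * (2 * Fintype.card X - I.card) := by nlinarith
      have h9 := hD' u
      rw [h4] at h1
      have h10 := mul_le_mul_of_nonneg_right h8 h0
      linarith
  · exfalso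
    rw [eventuallyEq_set, eventually_cofinite] at h
    refine infinite_halfSpace hX (1 * letter c) (bar c) (h.subset ?_)
    rw [← compl_halfSpace]
    intro p hp hp'
    exact hp ((hp'.2 trivial).2)
  · right; right; right
    obtain ⟨D', hD'⟩ := exists_cut_le hA'f h.symm
    refine ⟨D + D', fun u lo hi h0 hlo hhi hh => ?_⟩
    linarith [hgain u lo hi h0 hlo hhi hh, le_cut_halfSpace hlo g a, hD' u]
  · right; right; right
    refine ⟨C + D, fun u lo hi h0 hlo hhi hh => ?_⟩
    linarith [hgain u lo hi h0 hlo hhi hh, hC u lo hi h0 hlo hhi hh]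

lemma FiniteCut.trichotomy (hX : 2 ≤ Fintype.card X) {A : Set (FreeGroup X)} (hA : FiniteCut A) :
    Trichotomy A := by
  classical
  induction hn : (boundary A).ncard using Nat.strong_induction_on generalizing A with
  | _ n ih =>
  subst hn
  rcases (boundary A).eq_empty_or_nonempty with hb | hb
  · rcases eq_empty_or_univ_of_boundary hb with rfl | rfl
    · exact Or.inl (EventuallyEq.refl _ _)
    · exact Or.inr (Or.inl (EventuallyEq.refl _ _))
  obtain ⟨v, c, i, hic, hi, hconst⟩ := exists_vertex_const hA hb
  suffices H : Trichotomy (v⁻¹ • A) by simpa using H.smul v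
  have ih' : ∀ B, FiniteCut B → (boundary B).ncard < (boundary (v⁻¹ • A)).ncard →
      Trichotomy B := fun B hB hlt => by
    rw [ncard_boundary_smul] at hlt
    exact ih _ hlt hB rfl
  have hm : ∀ p, p ∈ v⁻¹ • A ↔ v * p ∈ A := fun p => by
    simp [Set.mem_smul_set_iff_inv_smul_mem]
  have hi' : (1, i) ∈ boundary (v⁻¹ • A) := by
    simpa [mem_boundary, hm] using hi
  have hconst' : ∀ j ≠ c, ∀ p ∈ halfSpace 1 j, (p ∈ v⁻¹ • A ↔ letter j ∈ v⁻¹ • A) := by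
    intro j hj p hp
    rw [hm, hm]
    refine hconst j hj _ ?_
    rw [mem_halfSpace_one] at hp
    simpa [mem_halfSpace] using hp
  set B := v⁻¹ • A with hB
  have hBf : FiniteCut B := hA.smul _
  rcases le_total (Finset.univ.filter fun j => j ≠ c ∧ letter j ∈ B).card
    (Finset.univ.filter fun j => j ≠ c ∧ letter j ∉ B).card with h | h
  · exact trichotomy_of_const hX hBf ih' hic hi' hconst' (by simp) (by simp) h
  · have := trichotomy_of_const hX hBf.compl (by rwa [boundary_compl]) hic
      (by rwa [boundary_compl]) (fun j hj p hp => not_congr (hconst' j hj p hp))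
      (fun j => by simp) (fun j => by simp) h
    simpa using this.compl

end Trichotomy

section Automorphisms

variable {X : Type}

lemma eventuallyEq_compl {A B : Set (FreeGroup X)} (h : A =ᶠ[cofinite] B) :
    (Aᶜ : Set (FreeGroup X)) =ᶠ[cofinite] (Bᶜ : Set (FreeGroup X)) := h.compl

lemma image_compl_mulAut (φ : MulAut (FreeGroup X)) (A : Set (FreeGroup X)) :
    φ '' Aᶜ = (φ '' A)ᶜ := Set.image_compl_eq φ.bijective

lemma image_inv_image (φ : MulAut (FreeGroup X)) (A : Set (FreeGroup X)) :
    (φ⁻¹ : MulAut (FreeGroup X)) '' (φ '' A) = A := by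
  rw [Set.image_image]
  simp

lemma eventuallyEq_of_image {φ : MulAut (FreeGroup X)} {A B : Set (FreeGroup X)}
    (h : φ '' A =ᶠ[cofinite] φ '' B) : A =ᶠ[cofinite] B := by
  have := eventuallyEq_image h φ⁻¹
  rwa [image_inv_image, image_inv_image] at this

variable [DecidableEq X]

lemma cut_halfSpace_eq (g : FreeGroup X) (a : X × Bool) (u : FreeGroup X) :
    cut (halfSpace g a) u = cut (halfSpace 1 (a.1, true)) u := by
  have h1 : ∀ g b, cut (halfSpace g b) u = cut (halfSpace 1 b) u := fun g b => by
    rw [← cut_smul g (halfSpace 1 b), smul_halfSpace, mul_one]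
  obtain ⟨x, s⟩ := a
  cases s with
  | true => exact h1 _ _
  | false =>
    rw [h1, ← cut_compl, compl_halfSpace, h1]
    rfl

/-- The image of every half-space agrees with a half-space up to a finite set. -/
def MapsHalfSpaces (φ : MulAut (FreeGroup X)) : Prop :=
  ∀ g a, ∃ k b, φ '' halfSpace g a =ᶠ[cofinite] halfSpace k b

/-- The vertex `h` is where `φ` sends the vertex `1` of the Cayley tree. -/
def MapsVertex (φ : MulAut (FreeGroup X)) (h : FreeGroup X) (π : X × Bool → X × Bool) : Prop :=
  ∀ a, φ '' halfSpace 1 a =ᶠ[cofinite] halfSpace h (π a)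

lemma MapsVertex.image_halfSpace {φ : MulAut (FreeGroup X)} {h : FreeGroup X}
    {π : X × Bool → X × Bool} (H : MapsVertex φ h π) (g : FreeGroup X) (a : X × Bool) :
    φ '' halfSpace g a =ᶠ[cofinite] halfSpace (φ g * h) (π a) := by
  have := eventuallyEq_smul (H a) (φ g)
  rwa [← image_smul_set, smul_halfSpace, smul_halfSpace, mul_one] at this

lemma MapsVertex.mul {φ ψ : MulAut (FreeGroup X)} {h k : FreeGroup X}
    {π ρ : X × Bool → X × Bool} (H : MapsVertex φ h π) (K : MapsVertex ψ k ρ) :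
    MapsVertex (φ * ψ) (φ k * h) (π ∘ ρ) := fun a => by
  rw [MulAut.coe_mul, Set.image_comp]
  exact (eventuallyEq_image (K a) φ).trans (H.image_halfSpace k (ρ a))

lemma mapsVertex_conj (u : FreeGroup X) : MapsVertex (MulAut.conj u) u id := fun a => by
  have h1 := eventually_cofinite.2 (finiteCut_halfSpace 1 a u)
  have h2 := (eventuallyEq_set.2 (h1.mono fun g hg => by
    simpa [mem_cutSet] using hg) : halfSpace 1 a =ᶠ[cofinite] (fun g => g * u) ⁻¹' halfSpace 1 a)
  have h3 := eventuallyEq_smul h2.symm u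
  rw [smul_halfSpace, mul_one] at h3
  suffices he : MulAut.conj u '' halfSpace 1 a = u • (fun g => g * u) ⁻¹' halfSpace 1 a by
    rw [he]
    exact h3
  ext g
  rw [Set.mem_smul_set_iff_inv_smul_mem]
  constructor
  · rintro ⟨x, hx, rfl⟩
    simpa [mul_assoc] using hx
  · intro hg
    exact ⟨u⁻¹ * g * u, by simpa using hg, by simp [mul_assoc]⟩

lemma eq_or_eq_of_between {g : FreeGroup X} {a b c : X × Bool}
    (h₁ : halfSpace 1 b ⊆ halfSpace g c) (h₂ : halfSpace g c ⊆ (halfSpace 1 a)ᶜ) :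
    halfSpace g c = halfSpace 1 b ∨ halfSpace g c = (halfSpace 1 a)ᶜ := by
  have hb := h₁ (mul_letter_mem_halfSpace 1 b)
  have ha : 1 * letter a ∉ halfSpace g c := fun h => h₂ h (mul_letter_mem_halfSpace 1 a)
  by_cases h : 1 ∈ halfSpace g c
  · right
    obtain ⟨h3, h4⟩ := eq_of_cross (x := bar a) ha (by simpa using h)
    rw [compl_halfSpace, h3, h4]
  · left
    obtain ⟨h3, h4⟩ := eq_of_cross h hb
    rw [h3, h4]

lemma exists_halfSpace_between {g k : FreeGroup X} {a b : X × Bool} (hgk : g ≠ k)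
    (hdis : halfSpace k b ⊆ (halfSpace g a)ᶜ) (hne : halfSpace k b ≠ (halfSpace g a)ᶜ) :
    ∃ d, halfSpace k b ⊆ halfSpace g d ∧ halfSpace g d ⊆ (halfSpace g a)ᶜ := by
  obtain h | ⟨d, hd'⟩ := hd_cases (g⁻¹ * k)
  · exact absurd (inv_mul_eq_one.1 h) hgk
  refine ⟨d, ?_, ?_⟩
  · have hg : g ∉ halfSpace k b := by
      intro hg
      have h1 : g * letter a ∉ halfSpace k b := fun h => hdis h (mul_letter_mem_halfSpace g a)
      have h2 : g * letter a ∈ (halfSpace k b)ᶜ := h1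
      have h3 : g ∉ (halfSpace k b)ᶜ := by simpa
      rw [compl_halfSpace] at h2 h3
      obtain ⟨h4, h5⟩ := eq_of_cross h3 h2
      apply hne
      rw [h4, h5, ← compl_halfSpace, compl_compl]
    intro p hp
    have h6 : p = k * (k⁻¹ * p) := by simp
    rw [h6]
    refine mul_mem_halfSpace hd' fun c hc e he => ?_
    rw [mem_halfSpace, hd] at hp
    rw [hp] at he
    obtain rfl := Option.some.inj he
    rintro rfl
    apply hg
    rw [mem_halfSpace, hd, ← inv_inv (k⁻¹ * g), mul_inv_rev, inv_inv, toWord_inv]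
    obtain ⟨L, hL⟩ : ∃ L, (g⁻¹ * k).toWord = L ++ [c] := by
      exact List.getLast?_eq_some_iff.1 hc
    rw [hL]
    simp [invRev, bar]
  · intro p hp hp'
    rw [mem_halfSpace] at hp hp'
    rw [hp] at hp'
    obtain rfl := Option.some.inj hp'
    have h1 : k * letter b ∈ (halfSpace g d)ᶜ := hdis (mul_letter_mem_halfSpace k b)
    have h2 : k ∉ (halfSpace g d)ᶜ := by simpa [mem_halfSpace] using hd'
    rw [compl_halfSpace] at h1 h2
    obtain ⟨h4, h5⟩ := eq_of_cross h2 h1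
    apply hne
    rw [h4, h5, ← compl_halfSpace]

variable [Fintype X]

lemma MapsVertex.unique (hX : 2 ≤ Fintype.card X) {φ : MulAut (FreeGroup X)} {h k : FreeGroup X}
    {π ρ : X × Bool → X × Bool} (H : MapsVertex φ h π) (K : MapsVertex φ k ρ) : h = k := by
  obtain ⟨a, -⟩ := exists_letter_ne hX ∅ (by simp)
  exact (halfSpace_eq_of_eventuallyEq hX ((H a).symm.trans (K a))).1

lemma MapsVertex.apply_letter (hX : 2 ≤ Fintype.card X) {φ : MulAut (FreeGroup X)}
    {h : FreeGroup X} {π : X × Bool → X × Bool} (H : MapsVertex φ h π) (a : X × Bool) :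
    φ (letter a) * h = h * letter (π a) := by
  have h1 : φ '' (halfSpace 1 a)ᶜ =ᶠ[cofinite] ((halfSpace h (π a))ᶜ : Set _) := by
    rw [image_compl_mulAut]
    exact eventuallyEq_compl (H a)
  rw [compl_halfSpace 1, compl_halfSpace h, one_mul] at h1
  exact (halfSpace_eq_of_eventuallyEq hX ((H.image_halfSpace _ _).symm.trans h1)).1

lemma MapsHalfSpaces.exists_mapsVertex (hX : 2 ≤ Fintype.card X) {φ : MulAut (FreeGroup X)}
    (H : MapsHalfSpaces φ) (H' : MapsHalfSpaces φ⁻¹) : ∃ h π, MapsVertex φ h π := by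
  choose h π hπ using H 1
  suffices key : ∀ a b, h a = h b by
    obtain ⟨a, -⟩ := exists_letter_ne hX ∅ (by simp)
    exact ⟨h a, π, fun b => key a b ▸ hπ b⟩
  intro a b
  by_contra hab
  have hne : a ≠ b := fun h => hab (by rw [h])
  have hcompl : φ '' (halfSpace 1 a)ᶜ =ᶠ[cofinite] ((halfSpace (h a) (π a))ᶜ : Set _) := by
    rw [image_compl_mulAut]
    exact eventuallyEq_compl (hπ a)
  have hsub : halfSpace 1 b ⊆ (halfSpace 1 a)ᶜ := by
    intro p hp hp'
    rw [mem_halfSpace_one] at hp hp'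
    exact hne (Option.some.inj (hp'.symm.trans hp))
  have hdis : halfSpace (h b) (π b) ⊆ (halfSpace (h a) (π a))ᶜ := by
    rw [compl_halfSpace]
    refine halfSpace_subset_of_le hX ?_
    rw [← compl_halfSpace]
    exact (hπ b).symm.le.trans ((eventuallyLE_image hsub.eventuallyLE φ).trans hcompl.le)
  have hne' : halfSpace (h b) (π b) ≠ (halfSpace (h a) (π a))ᶜ := by
    intro he
    have h1 := eventuallyEq_of_image ((hπ b).trans (he ▸ hcompl.symm))
    rw [compl_halfSpace] at h1
    have h2 := (halfSpace_eq_of_eventuallyEq hX h1).1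
    have := congrArg (fun g => g.toWord.length) h2
    simp at this
  obtain ⟨d, h1, h2⟩ := exists_halfSpace_between hab hdis hne'
  obtain ⟨g, c, hgc⟩ := H' (h a) d
  have hb' : (φ⁻¹ : MulAut (FreeGroup X)) '' halfSpace (h b) (π b) =ᶠ[cofinite] halfSpace 1 b := by
    simpa only [image_inv_image] using (eventuallyEq_image (hπ b) φ⁻¹).symm
  have ha' : (φ⁻¹ : MulAut (FreeGroup X)) '' (halfSpace (h a) (π a))ᶜ =ᶠ[cofinite] ((halfSpace 1 a)ᶜ : Set _) := by
    simpa only [image_inv_image] using (eventuallyEq_image hcompl φ⁻¹).symm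
  have h3 : halfSpace 1 b ⊆ halfSpace g c := halfSpace_subset_of_le hX
    (hb'.symm.le.trans ((eventuallyLE_image h1.eventuallyLE φ⁻¹).trans hgc.le))
  have h4 : halfSpace g c ⊆ (halfSpace 1 a)ᶜ := by
    rw [compl_halfSpace]
    refine halfSpace_subset_of_le hX ?_
    rw [← compl_halfSpace]
    exact hgc.symm.le.trans ((eventuallyLE_image h2.eventuallyLE φ⁻¹).trans ha'.le)
  rcases eq_or_eq_of_between h3 h4 with he | he
  · have := eventuallyEq_of_image (hgc.trans (he ▸ hb'.symm))
    exact hab (halfSpace_eq_of_eventuallyEq hX this).1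
  · have := eventuallyEq_of_image (hgc.trans (he ▸ ha'.symm))
    rw [compl_halfSpace] at this
    have h5 := (halfSpace_eq_of_eventuallyEq hX this).1
    have := congrArg (fun g => g.toWord.length) (left_eq_mul.1 h5)
    simp at this

/-- Powers of `u` take all turns about equally often. -/
def Balanced (u : FreeGroup X) : Prop :=
  ∃ l h : ℝ, 0 < l ∧ 2 * Fintype.card X * h < (2 * Fintype.card X + 1) * l ∧
    ∀ m : ℕ, 1 ≤ m → ∀ i j, i ≠ j → m * l ≤ turn (u ^ m) i j ∧ turn (u ^ m) i j ≤ m * h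

lemma eq_of_image_eventuallyEq (hX : 2 ≤ Fintype.card X) {φ : MulAut (FreeGroup X)} {x y : X}
    {g k : FreeGroup X} {a b : X × Bool}
    (hx : φ '' halfSpace 1 (x, true) =ᶠ[cofinite] halfSpace g a)
    (hy : φ '' halfSpace 1 (y, true) =ᶠ[cofinite] halfSpace k b) (hab : a.1 = b.1) : x = y := by
  have key : ∀ k, φ '' halfSpace (φ⁻¹ (k * g⁻¹)) (x, true) =ᶠ[cofinite] halfSpace k a := fun k => by
    have := eventuallyEq_smul hx (k * g⁻¹)
    rw [smul_halfSpace, inv_mul_cancel_right] at this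
    have h1 := image_smul_set φ (φ⁻¹ (k * g⁻¹)) (halfSpace 1 (x, true))
    rw [smul_halfSpace, mul_one, MulAut.apply_inv_self] at h1
    rwa [h1]
  by_cases h : a = b
  · have h2 := halfSpace_eq_of_eventuallyEq hX (eventuallyEq_of_image ((h ▸ key k).trans hy.symm))
    exact (Prod.ext_iff.1 h2.2).1
  · have hb : b = bar a := by
      obtain ⟨z, s⟩ := a
      obtain ⟨w, t⟩ := b
      simp only at hab
      subst hab
      cases s <;> cases t <;> simp_all [bar]
    have h1 := eventuallyEq_compl (key (k * letter b))
    rw [← image_compl_mulAut, compl_halfSpace, compl_halfSpace, hb, letter_bar,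
      inv_mul_cancel_right, ← hb] at h1
    exact (Prod.ext_iff.1 (halfSpace_eq_of_eventuallyEq hX
      (eventuallyEq_of_image (h1.trans hy.symm))).2).1

lemma Balanced.image_halfSpace (hX : 2 ≤ Fintype.card X) {u : FreeGroup X} (hu : Balanced u)
    {φ : MulAut (FreeGroup X)} (hφ : φ u = u) (x : X) :
    ∃ g a, φ '' halfSpace 1 (x, true) =ᶠ[cofinite] halfSpace g a := by
  classical
  obtain ⟨l, h, hl, hlh, hturn⟩ := hu
  have hXr : (2 : ℝ) ≤ Fintype.card X := by exact_mod_cast hX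
  have hh2 : h ≤ 2 * l := by
    by_contra! hlt
    nlinarith
  set P : X → Prop := fun x => ∃ g a, φ '' halfSpace 1 (x, true) =ᶠ[cofinite] halfSpace g a with hP
  have hlarge : ∀ x, ¬ P x → LargeCut (φ '' halfSpace 1 (x, true)) := by
    intro x hx
    rcases ((finiteCut_halfSpace 1 (x, true)).image φ).trichotomy hX with h' | h' | h' | h'
    · exfalso
      rw [eventuallyEq_set, eventually_cofinite] at h'
      refine ((infinite_halfSpace hX 1 (x, true)).image φ.injective.injOn) (h'.subset ?_)
      intro p hp hp'
      exact hp'.1 hp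
    · exfalso
      rw [eventuallyEq_set, eventually_cofinite] at h'
      refine ((infinite_halfSpace hX (1 * letter (x, true)) (bar (x, true))).image
        φ.injective.injOn) (h'.subset ?_)
      rw [← compl_halfSpace, image_compl_mulAut]
      intro p hp hp'
      exact hp (hp'.2 trivial)
    · exact absurd h' hx
    · exact h'
  set K : ℕ → X → ℝ := fun m x => cut (halfSpace 1 (x, true)) (u ^ m) with hK
  have hKφ : ∀ m x, (cut (φ '' halfSpace 1 (x, true)) (u ^ m) : ℝ) = K m x := fun m x => by
    have := cut_image φ (halfSpace 1 (x, true)) (u ^ m)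
    rw [map_pow, hφ] at this
    rw [this]
  have hf : ∃ f : X → X, ∃ C : X → ℝ, (∀ x y, P x → P y → f x = f y → x = y) ∧
      (∀ x, P x → ∀ m, K m (f x) ≤ K m x + C x) ∧
      ∀ x, ¬ P x → ∀ m : ℕ, 1 ≤ m →
        m * ((2 * Fintype.card X + 1) * l - h) ≤ K m x + C x := by
    have hpt : ∀ x, ∃ y : X, ∃ C : ℝ, (P x → ∃ g a, a.1 = y ∧
        φ '' halfSpace 1 (x, true) =ᶠ[cofinite] halfSpace g a) ∧
        (P x → ∀ m, K m y ≤ K m x + C) ∧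
        (¬ P x → ∀ m : ℕ, 1 ≤ m → m * ((2 * Fintype.card X + 1) * l - h) ≤ K m x + C) := by
      intro x
      by_cases hx : P x
      · obtain ⟨g, a, hga⟩ := hx
        obtain ⟨C, hC⟩ := exists_cut_le ((finiteCut_halfSpace 1 (x, true)).image φ) hga.symm
        refine ⟨a.1, C, fun _ => ⟨g, a, rfl, hga⟩, fun _ m => ?_, fun hn => absurd ⟨g, a, hga⟩ hn⟩
        rw [← hKφ m x]
        simpa only [hK, ← cut_halfSpace_eq g a] using hC (u ^ m)
      · obtain ⟨C, hC⟩ := hlarge x hx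
        refine ⟨x, C, fun hn => absurd hn hx, fun hn => absurd hn hx, fun _ m hm => ?_⟩
        have hm' : (1 : ℝ) ≤ m := by exact_mod_cast hm
        have := hC (u ^ m) (m * l) (m * h) (by positivity) (fun i j hij => (hturn m hm i j hij).1)
          (fun i j hij => (hturn m hm i j hij).2)
          (by linarith [mul_le_mul_of_nonneg_left hh2 (Nat.cast_nonneg (α := ℝ) m)])
        rw [hKφ] at this
        linarith
    choose f C h1 h2 h3 using hpt
    refine ⟨f, C, fun x y hx hy hxy => ?_, h2, h3⟩
    obtain ⟨g, a, ha, hga⟩ := h1 x hx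
    obtain ⟨k, b, hb, hkb⟩ := h1 y hy
    exact eq_of_image_eventuallyEq hX hga hkb (by rw [ha, hb, hxy])
  obtain ⟨f, C, hinj, hC1, hC2⟩ := hf
  by_contra hx
  change ¬ P x at hx
  set S := Finset.univ.filter P with hS
  have hinj' : Set.InjOn f S := fun y hy z hz h => by
    simp only [hS, Finset.coe_filter, Finset.mem_univ, true_and, Set.mem_ofPred_eq] at hy hz
    exact hinj y z hy hz h
  set d : ℝ := (Sᶜ.card : ℝ) with hd
  have hd1 : 1 ≤ d := by
    have : 0 < Sᶜ.card := Finset.card_pos.2 ⟨x, by simp [hS, hx]⟩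
    rw [hd]
    exact_mod_cast this
  have hbound : ∀ m : ℕ, 1 ≤ m →
      m * (d * ((2 * Fintype.card X + 1) * l - 2 * Fintype.card X * h)) ≤ 2 * d + ∑ x, C x := by
    intro m hm
    have h1 : ∑ y ∈ S, K m (f y) ≤ ∑ y ∈ S, (K m y + C y) :=
      Finset.sum_le_sum fun y hy => hC1 y (by simpa [hS] using hy) m
    have h2 : ∑ y ∈ Sᶜ, (m * ((2 * Fintype.card X + 1) * l - h)) ≤ ∑ y ∈ Sᶜ, (K m y + C y) :=
      Finset.sum_le_sum fun y hy => hC2 y (by simpa [hS] using hy) m hm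
    have h3 : ∑ y ∈ S.image f, K m y = ∑ y ∈ S, K m (f y) := Finset.sum_image hinj'
    have h4 : ∑ y ∈ (S.image f)ᶜ, K m y ≤
        ∑ y ∈ (S.image f)ᶜ, ((2 * Fintype.card X - 1) * (m * h) + 2) :=
      Finset.sum_le_sum fun y _ => cut_halfSpace_le (fun i j hij => (hturn m hm i j hij).2) 1 _
    have h5 : (((S.image f)ᶜ.card : ℕ) : ℝ) = d := by
      rw [hd, Finset.card_compl, Finset.card_compl, Finset.card_image_of_injOn hinj']
    have h6 := Finset.sum_add_sum_compl S fun y => K m y + C y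
    have h7 := Finset.sum_add_sum_compl (S.image f) (K m)
    rw [Finset.sum_const, nsmul_eq_mul] at h2 h4
    rw [h5] at h4
    rw [← hd] at h2
    rw [Finset.sum_add_distrib (s := Finset.univ)] at h6
    linarith
  set δ := d * ((2 * Fintype.card X + 1) * l - 2 * Fintype.card X * h) with hδ
  have hδ0 : 0 < δ := mul_pos (by linarith) (by linarith)
  obtain ⟨m, hm⟩ := exists_nat_gt ((2 * d + ∑ x, C x) / δ)
  rw [div_lt_iff₀ hδ0] at hm
  have := hbound (m + 1) (by omega)
  push_cast at this
  linarith

lemma Balanced.mapsHalfSpaces (hX : 2 ≤ Fintype.card X) {u : FreeGroup X} (hu : Balanced u)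
    {φ : MulAut (FreeGroup X)} (hφ : φ u = u) : MapsHalfSpaces φ := by
  intro g a
  obtain ⟨x, s⟩ := a
  obtain ⟨k, b, hk⟩ := hu.image_halfSpace hX hφ x
  have key : ∀ g, φ '' halfSpace g (x, true) =ᶠ[cofinite] halfSpace (φ g * k) b := fun g => by
    have := eventuallyEq_smul hk (φ g)
    rwa [← image_smul_set, smul_halfSpace, smul_halfSpace, mul_one] at this
  cases s with
  | true => exact ⟨_, _, key g⟩
  | false =>
    have h1 := eventuallyEq_compl (key (g * letter (x, false)))
    rw [← image_compl_mulAut, compl_halfSpace, compl_halfSpace, mul_assoc] at h1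
    have h2 : letter (x, false) = (letter (x, true))⁻¹ := letter_bar (x, true)
    rw [h2, inv_mul_cancel, mul_one] at h1
    exact ⟨_, _, h1⟩

lemma Balanced.exists_mapsVertex (hX : 2 ≤ Fintype.card X) {u : FreeGroup X} (hu : Balanced u)
    {φ : MulAut (FreeGroup X)} (hφ : φ u = u) : ∃ h π, MapsVertex φ h π := by
  refine (hu.mapsHalfSpaces hX hφ).exists_mapsVertex hX (hu.mapsHalfSpaces hX ?_)
  conv_lhs => rw [← hφ]
  exact MulAut.inv_apply_self _ φ u

end Automorphisms

section Axis

variable {X : Type}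

/-- The word read along `k` consecutive edges of a line, from position `i` on. -/
def seg (a : ℤ → X × Bool) : ℤ → ℕ → List (X × Bool)
  | _, 0 => []
  | i, k + 1 => a i :: seg a (i + 1) k

@[simp] lemma length_seg (a : ℤ → X × Bool) (i : ℤ) (k : ℕ) : (seg a i k).length = k := by
  induction k generalizing i with
  | zero => rfl
  | succ k ih => simp [seg, ih]

lemma seg_succ (a : ℤ → X × Bool) (i : ℤ) (k : ℕ) :
    seg a i (k + 1) = seg a i k ++ [a (i + k)] := by
  induction k generalizing i with
  | zero => simp [seg]
  | succ k ih =>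
    rw [seg, ih, seg, List.cons_append]
    congr 4
    push_cast
    ring

lemma mul_mk_seg {a : ℤ → X × Bool} {p : ℤ → FreeGroup X}
    (hp : ∀ i, p (i + 1) = p i * letter (a i)) (i : ℤ) (k : ℕ) :
    p (i + k) = p i * mk (seg a i k) := by
  induction k generalizing i with
  | zero => simp [seg, ← one_eq_mk]
  | succ k ih =>
    have := ih (i + 1)
    rw [hp] at this
    rw [seg, ← List.singleton_append, ← mul_mk, ← mul_assoc, ← letter, ← this]
    congr 1
    push_cast
    ring

/-- `p` enumerates the vertices of the axis of `u` in the Cayley tree, `a` its edge labels. -/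
structure IsAxis (u : FreeGroup X) (n : ℕ) (a : ℤ → X × Bool) (p : ℤ → FreeGroup X) : Prop where
  pos : 0 < n
  zero : p 0 = 1
  step : ∀ i, p (i + 1) = p i * letter (a i)
  period : ∀ i, p (i + n) = u * p i
  reduced : ∀ i, a (i + 1) ≠ bar (a i)

lemma exists_isAxis {L : List (X × Bool)} (hL : IsCyclicallyReduced L) (hne : L ≠ []) :
    ∃ a p, IsAxis (mk L) L.length a p ∧ ∀ b ∈ L, ∃ i, a i = b := by
  have hn : 0 < L.length := List.length_pos_iff.2 hne
  set n := L.length with hn'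
  set e := L.head hne
  have hmod : ∀ (r : ℕ) (d : ℤ), r < n → ((r + d * n : ℤ) % n).toNat = r := by
    intro r d hr
    rw [Int.add_mul_emod_self_right, Int.emod_eq_of_lt (by positivity) (by exact_mod_cast hr)]
    rfl
  have hdiv : ∀ (r : ℕ) (d : ℤ), r < n → (r + d * n : ℤ) / n = d := by
    intro r d hr
    rw [Int.add_mul_ediv_right _ _ (by exact_mod_cast hn.ne'),
      Int.ediv_eq_zero_of_lt (by positivity) (by exact_mod_cast hr), zero_add]
  have hrep : ∀ i : ℤ, ∃ (r : ℕ) (d : ℤ), r < n ∧ i = r + d * n := by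
    intro i
    have h1 : 0 ≤ i % n := Int.emod_nonneg _ (by exact_mod_cast hn.ne')
    have h2 : i % n < n := Int.emod_lt_of_pos _ (by exact_mod_cast hn)
    refine ⟨(i % n).toNat, i / n, by omega, ?_⟩
    rw [Int.toNat_of_nonneg h1, mul_comm, Int.emod_add_mul_ediv]
  have hrep' : ∀ (r : ℕ) (d : ℤ), r + 1 = n → (r + d * n + 1 : ℤ) = (0 : ℕ) + (d + 1) * n := by
    intro r d h
    rw [← h]
    push_cast
    ring
  have hrep2 : ∀ (r : ℕ) (d : ℤ), (r + d * n + 1 : ℤ) = (r + 1 : ℕ) + d * n := by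
    intro r d
    push_cast
    ring
  refine ⟨fun i => L.getD (i % n).toNat e, fun i => mk L ^ (i / n) * mk (L.take (i % n).toNat),
    ⟨hn, ?_, ?_, ?_, ?_⟩, ?_⟩
  · simp [← one_eq_mk]
  · intro i
    obtain ⟨r, d, hr, rfl⟩ := hrep i
    have hget : mk (L.take r) * letter (L.getD r e) = mk (L.take (r + 1)) := by
      rw [letter, mul_mk, List.take_add_one]
      simp [hn' ▸ hr]
    rcases Nat.lt_or_ge (r + 1) n with h | h
    · rw [hrep2, hmod _ _ h, hdiv _ _ h, hmod _ _ hr, hdiv _ _ hr, mul_assoc, hget]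
    · have h' : r + 1 = n := by omega
      rw [hrep' _ _ h', hmod _ _ hn, hdiv _ _ hn, hmod _ _ hr, hdiv _ _ hr, mul_assoc, hget, h',
        zpow_add_one]
      simp [hn', ← one_eq_mk]
  · intro i
    obtain ⟨r, d, hr, rfl⟩ := hrep i
    have h2 : (r + d * n + n : ℤ) = r + (d + 1) * n := by ring
    rw [h2, hmod _ _ hr, hdiv _ _ hr, hmod _ _ hr, hdiv _ _ hr, ← mul_assoc, add_comm,
      zpow_one_add]
  · intro i
    obtain ⟨r, d, hr, rfl⟩ := hrep i
    have hLL : IsReduced (L ++ L) := by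
      have := (hL.flatten_replicate 2).isReduced
      simpa using this
    have hg : ∀ r (hr : r < n), L.getD r e = (L ++ L)[r]'(by simp; omega) := by
      intro r hr
      simp [hn' ▸ hr]
    have hg' : ∀ h : n < (L ++ L).length, L.getD 0 e = (L ++ L)[n]'h := by
      intro h
      simp [hn', hn' ▸ hn]
    have key : ∀ x y : X × Bool, IsReduced [x, y] → y ≠ bar x := fun x y h =>
      (isReduced_cons_cons.1 h).1
    have hch : IsReduced [(L ++ L)[r]'(by simp; omega), (L ++ L)[r + 1]'(by simp; omega)] := by
      have := List.isChain_iff_getElem.1 hLL r (by simp; omega)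
      simpa [FreeGroup.IsReduced] using this
    apply key
    rcases Nat.lt_or_ge (r + 1) n with h | h
    · rwa [hrep2, hmod _ _ h, hmod _ _ hr, hg _ hr, hg _ h]
    · have h' : r + 1 = n := by omega
      rw [hrep' _ _ h', hmod _ _ hn, hmod _ _ hr, hg _ hr, hg' (by simp; omega)]
      simpa [h'] using hch
  · intro b hb
    obtain ⟨r, hr, rfl⟩ := List.mem_iff_getElem.1 hb
    refine ⟨(r : ℤ) + 0 * n, ?_⟩
    simp only
    rw [hmod _ _ hr]
    have hr' : r < L.length := hr
    simp [hr']

namespace IsAxis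

variable {u : FreeGroup X} {n : ℕ} {a : ℤ → X × Bool} {p : ℤ → FreeGroup X}

lemma isReduced_seg (H : IsAxis u n a p) (i : ℤ) (k : ℕ) : IsReduced (seg a i k) := by
  induction k generalizing i with
  | zero => simp [seg, FreeGroup.IsReduced]
  | succ k ih =>
    cases k with
    | zero => simp [seg, FreeGroup.IsReduced]
    | succ k => exact isReduced_cons_cons.2 ⟨H.reduced i, ih (i + 1)⟩

variable [DecidableEq X]

lemma toWord_seg (H : IsAxis u n a p) (i : ℤ) (k : ℕ) : (FreeGroup.mk (seg a i k)).toWord = seg a i k :=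
  toWord_mk_of_isReduced (H.isReduced_seg i k)

lemma injective (H : IsAxis u n a p) : Function.Injective p := by
  have key : ∀ (i : ℤ) (k : ℕ), p (i + k) = p i → k = 0 := by
    intro i k h
    rw [mul_mk_seg H.step, mul_eq_left, ← toWord_eq_nil_iff, H.toWord_seg] at h
    simpa using congrArg List.length h
  intro i j hij
  rcases le_total i j with h | h
  · obtain ⟨k, rfl⟩ := Int.le.dest h
    simp [key i k hij.symm]
  · obtain ⟨k, rfl⟩ := Int.le.dest h
    simp [key j k hij]

lemma label_add (H : IsAxis u n a p) (i : ℤ) : a (i + n) = a i := by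
  have h1 := H.step (i + n)
  rw [show i + n + 1 = i + 1 + n by ring, H.period, H.period, H.step] at h1
  have : letter (a i) = letter (a (i + n)) := by simpa [mul_assoc] using h1
  have := congrArg toWord this
  simpa using this.symm

/-- Among all vertices, those on the axis are moved the least. -/
lemma exists_eq_of_norm_le (H : IsAxis u n a p) {h : FreeGroup X}
    (hh : FreeGroup.norm (h⁻¹ * u * h) ≤ n) : ∃ s, h = p s := by
  obtain ⟨t, ht⟩ : ∃ t, ∀ s, FreeGroup.norm ((p t)⁻¹ * h) ≤ FreeGroup.norm ((p s)⁻¹ * h) := by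
    obtain ⟨t, -, ht⟩ := (measure fun t => FreeGroup.norm ((p t)⁻¹ * h)).wf.has_min Set.univ ⟨0, trivial⟩
    exact ⟨t, fun s => not_lt.1 (ht s trivial)⟩
  refine ⟨t, ?_⟩
  set z := (p t)⁻¹ * h with hz
  have h1 : hd z ≠ some (a t) := by
    intro hd1
    obtain ⟨y, hy, hy'⟩ := exists_letter_mul_of_hd hd1
    have := ht (t + 1)
    rw [H.step, mul_inv_rev, mul_assoc, ← hz, hy, inv_mul_cancel_left, ← hy, FreeGroup.norm, FreeGroup.norm, hy'] at this
    simp at this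
  have h2 : hd z ≠ some (bar (a (t - 1))) := by
    intro hd1
    obtain ⟨y, hy, hy'⟩ := exists_letter_mul_of_hd hd1
    have h3 := ht (t - 1)
    have h4 : (p (t - 1))⁻¹ * h = letter (a (t - 1)) * z := by
      have := H.step (t - 1)
      rw [sub_add_cancel] at this
      rw [hz, this]
      group
    rw [h4, hy, letter_bar, mul_inv_cancel_left, ← letter_bar, ← hy, FreeGroup.norm, FreeGroup.norm, hy'] at h3
    simp at h3
  obtain ⟨m, rfl⟩ : ∃ m, n = m + 1 := ⟨n - 1, by have := H.pos; omega⟩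
  have h5 : h⁻¹ * u * h = z⁻¹ * (FreeGroup.mk (seg a t (m + 1)) * z) := by
    have := H.period t
    rw [mul_mk_seg H.step] at this
    rw [show FreeGroup.mk (seg a t (m + 1)) = (p t)⁻¹ * (u * p t) by rw [← this]; group, hz]
    group
  have h6 : (FreeGroup.mk (seg a t (m + 1)) * z).toWord = seg a t (m + 1) ++ z.toWord := by
    rw [toWord_mul_of_ne, H.toWord_seg]
    rw [H.toWord_seg, seg_succ]
    simp only [List.getLast?_append, List.getLast?_singleton, Option.some_or, Option.mem_def,
      Option.some.injEq, forall_eq']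
    rintro b hb rfl
    apply h2
    rw [hd, hb, ← H.label_add (t - 1)]
    push_cast
    congr 3
    ring
  have h7 : (h⁻¹ * u * h).toWord = z⁻¹.toWord ++ (seg a t (m + 1) ++ z.toWord) := by
    rw [h5, toWord_mul_of_ne, h6]
    rw [h6, seg]
    simp only [toWord_inv, invRev, List.getLast?_reverse, List.head?_map, Option.mem_def,
      List.cons_append, List.head?_cons, Option.some.injEq, forall_eq']
    intro b hb hab
    apply h1
    obtain ⟨c, hc, rfl⟩ := Option.map_eq_some_iff.1 hb
    rw [hd, hc, hab]
    simp [bar]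
  rw [FreeGroup.norm, h7] at hh
  have : z.toWord = [] := by
    rw [← List.length_eq_zero_iff]
    simp only [List.length_append, length_seg] at hh
    omega
  rw [toWord_eq_nil_iff] at this
  exact (inv_mul_eq_one.1 (hz ▸ this)).symm


/-- An automorphism fixing `u` acts on the axis of `u` as a translation. -/
lemma exists_translation [Fintype X] (H : IsAxis u n a p) (hX : 2 ≤ Fintype.card X)
    {φ : MulAut (FreeGroup X)} {h : FreeGroup X} {π : X × Bool → X × Bool} (hφ : φ u = u)
    (K : MapsVertex φ h π) : ∃ t, h = p t ∧ ∀ i, φ (p i) * h = p (t + i) := by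
  have hstep : ∀ i, φ (p (i + 1)) * h = φ (p i) * h * letter ((π ∘ a) i) := by
    intro i
    rw [H.step, _root_.map_mul, mul_assoc, K.apply_letter hX, ← mul_assoc, Function.comp]
  have key : ∀ i, ∃ s, φ (p i) * h = p s ∧ φ (p (i + 1)) * h = p (s + 1) := by
    intro i
    have h1 : (φ (p i) * h)⁻¹ * u * (φ (p i) * h) = FreeGroup.mk (seg (π ∘ a) i n) := by
      have := mul_mk_seg (p := fun i => φ (p i) * h) hstep i n
      rw [H.period, _root_.map_mul, hφ] at this
      rw [mul_assoc, ← mul_assoc u, this, inv_mul_cancel_left]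
    obtain ⟨s, hs⟩ := H.exists_eq_of_norm_le (h := φ (p i) * h) (by
      rw [h1]
      exact norm_mk_le.trans_eq (length_seg _ _ _))
    refine ⟨s, hs, ?_⟩
    have h2 : (p s)⁻¹ * u * p s = FreeGroup.mk (seg a s n) := by
      rw [mul_assoc, ← H.period, mul_mk_seg H.step, inv_mul_cancel_left]
    have h3 : reduce (seg (π ∘ a) i n) = seg a s n := by
      rw [← toWord_mk, ← h1, hs, h2, H.toWord_seg]
    have h4 : seg a s n = seg (π ∘ a) i n := by
      rw [← h3]
      refine (Red.sublist reduce.red).eq_of_length ?_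
      rw [h3, length_seg, length_seg]
    obtain ⟨m, rfl⟩ : ∃ m, n = m + 1 := ⟨n - 1, by have := H.pos; omega⟩
    rw [hstep, hs, H.step]
    simp only [seg, List.cons.injEq] at h4
    rw [h4.1]
  obtain ⟨t, ht, -⟩ := key 0
  refine ⟨t, by simpa [H.zero] using ht, fun i => ?_⟩
  induction i with
  | zero => simpa using ht
  | succ i ih =>
    obtain ⟨s, hs, hs'⟩ := key i
    rw [hs', ← add_assoc, H.injective (hs.symm.trans ih)]
  | pred i ih =>
    obtain ⟨s, hs, hs'⟩ := key (-i - 1)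
    rw [sub_add_cancel] at hs'
    rw [hs]
    congr 1
    have := H.injective (hs'.symm.trans ih)
    omega

/-- The stabilizer of an element whose axis carries every generator is infinite cyclic, as soon as
each automorphism in it sends half-spaces at a vertex to half-spaces at a vertex. -/
theorem nonempty_stabilizer_mulEquiv [Fintype X] (H : IsAxis u n a p) (hX : 2 ≤ Fintype.card X)
    (ha : ∀ x, ∃ i, (a i).1 = x)
    (hu : ∀ φ : MulAut (FreeGroup X), φ u = u → ∃ h π, MapsVertex φ h π) :
    Nonempty (MulAction.stabilizer (MulAut (FreeGroup X)) u ≃* Multiplicative ℤ) := by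
  have hs : ∀ φ : MulAction.stabilizer (MulAut (FreeGroup X)) u, φ.1 u = u := fun φ => φ.2
  choose h π K using fun φ : MulAction.stabilizer (MulAut (FreeGroup X)) u => hu φ.1 (hs φ)
  choose t ht ht' using fun φ => H.exists_translation hX (hs φ) (K φ)
  let T : MulAction.stabilizer (MulAut (FreeGroup X)) u →* Multiplicative ℤ :=
    MonoidHom.mk' (fun φ => Multiplicative.ofAdd (t φ)) fun φ ψ => by
      rw [← ofAdd_add]
      congr 1
      apply H.injective
      rw [← ht', ← ht ψ, ← ht (φ * ψ)]
      exact (K (φ * ψ)).unique hX ((K φ).mul (K ψ))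
  have hT : Function.Injective T := by
    rw [injective_iff_map_eq_one]
    intro φ hφ
    have hφ0 : t φ = 0 := hφ
    have hp : ∀ i, φ.1 (p i) = p i := by
      intro i
      have := ht' φ i
      rwa [ht φ, hφ0, H.zero, mul_one, zero_add] at this
    have hl : ∀ i, φ.1 (letter (a i)) = letter (a i) := by
      intro i
      have := H.step i
      rw [← inv_mul_eq_iff_eq_mul] at this
      rw [← this, _root_.map_mul, _root_.map_inv, hp, hp]
    ext1
    refine MulEquiv.toMonoidHom_injective (FreeGroup.ext_hom _ _ fun x => ?_)
    obtain ⟨i, rfl⟩ := ha x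
    change φ.1 (of (a i).1) = of (a i).1
    have := hl i
    rcases hi : a i with ⟨y, b⟩
    rw [hi] at this
    cases b with
    | true => exact this
    | false =>
      rw [show ((y, false) : X × Bool) = bar (y, true) from rfl, letter_bar, _root_.map_inv,
        inv_inj] at this
      exact this
  let c : MulAction.stabilizer (MulAut (FreeGroup X)) u :=
    ⟨MulAut.conj u, by simp [MulAction.mem_stabilizer_iff]⟩
  have hc : t c = n := by
    apply H.injective
    rw [← ht, ← zero_add (n : ℤ), H.period, H.zero, mul_one]
    exact (K c).unique hX (mapsVertex_conj u)
  have : Infinite (MulAction.stabilizer (MulAut (FreeGroup X)) u) := by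
    refine Infinite.of_injective (fun m : ℤ => c ^ m) fun i j hij => ?_
    have := congrArg (fun g => Multiplicative.toAdd (T g)) hij
    simp only [map_zpow, toAdd_zpow, smul_eq_mul] at this
    have h3 : (T c).toAdd = n := hc
    rw [h3] at this
    exact mul_right_cancel₀ (by exact_mod_cast H.pos.ne') this
  have := isCyclic_of_injective T hT
  exact ⟨(intCyclicMulEquiv).symm⟩

end IsAxis

end Axis

section Turns

variable {X : Type} [DecidableEq X]

/-- The number of occurrences of the two-letter word `a b` in a word. -/
def pairCount (a b : X × Bool) : List (X × Bool) → ℕ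
  | [] => 0
  | x :: L => (if x = a ∧ L.head? = some b then 1 else 0) + pairCount a b L

lemma pairCount_le_length (a b : X × Bool) (L : List (X × Bool)) :
    pairCount a b L ≤ L.length := by
  induction L with
  | nil => simp [pairCount]
  | cons x L ih =>
    rw [pairCount, List.length_cons]
    split_ifs <;> omega

lemma le_pairCount_append (a b : X × Bool) (L M : List (X × Bool)) :
    pairCount a b L + pairCount a b M ≤ pairCount a b (L ++ M) := by
  induction L with
  | nil => simp [pairCount]
  | cons x L ih =>
    rw [List.cons_append, pairCount, pairCount]
    cases L with
    | nil => simp [pairCount]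
    | cons y L =>
      have h : (y :: L ++ M).head? = (y :: L).head? := rfl
      rw [h]
      omega

lemma pairCount_append_le (a b : X × Bool) (L M : List (X × Bool)) :
    pairCount a b (L ++ M) ≤ pairCount a b L + pairCount a b M + 1 := by
  induction L with
  | nil => simp [pairCount]
  | cons x L ih =>
    rw [List.cons_append, pairCount, pairCount]
    cases L with
    | nil =>
      simp only [List.nil_append, pairCount]
      split_ifs <;> omega
    | cons y L =>
      have h : (y :: L ++ M).head? = (y :: L).head? := rfl
      rw [h]
      omega

lemma mem_of_pairCount_pos {a b : X × Bool} {L : List (X × Bool)} (h : 0 < pairCount a b L) :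
    a ∈ L := by
  induction L with
  | nil => simp [pairCount] at h
  | cons x L ih =>
    rw [pairCount] at h
    split_ifs at h with h'
    · simp [h'.1]
    · exact List.mem_cons_of_mem _ (ih (by omega))

lemma le_pairCount_flatten_replicate (a b : X × Bool) (L : List (X × Bool)) (m : ℕ) :
    m * pairCount a b L ≤ pairCount a b (List.replicate m L).flatten := by
  induction m with
  | zero => simp
  | succ m ih =>
    rw [List.replicate_succ, List.flatten_cons]
    have := le_pairCount_append a b L (List.replicate m L).flatten
    linarith

lemma pairCount_flatten_replicate_le (a b : X × Bool) (L : List (X × Bool)) (m : ℕ) :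
    pairCount a b (List.replicate m L).flatten ≤ m * (pairCount a b L + 1) := by
  induction m with
  | zero => simp [pairCount]
  | succ m ih =>
    rw [List.replicate_succ, List.flatten_cons]
    have := pairCount_append_le a b L (List.replicate m L).flatten
    linarith

lemma pairCount_eq_card (a b : X × Bool) (L : List (X × Bool)) :
    pairCount a b L =
      ((Finset.range L.length).filter fun k => L[k]? = some a ∧ L[k + 1]? = some b).card := by
  rw [Finset.card_filter]
  induction L with
  | nil => simp [pairCount]
  | cons x L ih =>
    rw [pairCount, ih, List.length_cons, Finset.sum_range_succ']
    rw [add_comm]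
    simp [List.head?_eq_getElem?]

/-- The inverse of the prefix of length `k + 1`. -/
def prefixInv (L : List (X × Bool)) (k : ℕ) : FreeGroup X := (FreeGroup.mk (L.take (k + 1)))⁻¹

lemma hd_prefixInv {L : List (X × Bool)} (hL : IsReduced L) {k : ℕ} (hk : k < L.length) :
    hd (prefixInv L k) = some (bar L[k]) := by
  have h : IsReduced (L.take (k + 1)) := hL.infix (L.take_prefix _).isInfix
  rw [hd, prefixInv, toWord_inv, toWord_mk_of_isReduced h, invRev, List.head?_reverse,
    List.getLast?_map, List.getLast?_take]
  simp [hk, bar]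

lemma hd_prefixInv_mul {L : List (X × Bool)} (hL : IsReduced L) (k : ℕ) :
    hd (prefixInv L k * FreeGroup.mk L) = L[k + 1]? := by
  have h : IsReduced (L.drop (k + 1)) := hL.infix (L.drop_suffix _).isInfix
  have h2 : FreeGroup.mk L = FreeGroup.mk (L.take (k + 1)) * FreeGroup.mk (L.drop (k + 1)) := by
    rw [mul_mk, List.take_append_drop]
  rw [hd, prefixInv, h2, inv_mul_cancel_left, toWord_mk_of_isReduced h, List.head?_drop]

lemma prefixInv_injOn {L : List (X × Bool)} (hL : IsReduced L) :
    Set.InjOn (prefixInv L) (Finset.range L.length) := by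
  intro i hi j hj hij
  have h : ∀ k, IsReduced (L.take (k + 1)) := fun k => hL.infix (L.take_prefix _).isInfix
  have := congrArg FreeGroup.norm hij
  simp only [Finset.coe_range, Set.mem_Iio] at hi hj
  simp only [prefixInv, norm_inv_eq] at this
  simp only [FreeGroup.norm, toWord_mk_of_isReduced (h _), List.length_take] at this
  omega

lemma exists_prefixInv {L : List (X × Bool)} (hL : IsReduced L) {g : FreeGroup X}
    {i j : X × Bool} (hij : i ≠ j) (hi : hd g = some i)
    (hj : hd (g * FreeGroup.mk L) = some j) :
    ∃ k, k < L.length ∧ L[k]? = some (bar i) ∧ L[k + 1]? = some j ∧ prefixInv L k = g := by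
  obtain ⟨P, Q, S, h1, h2, h3⟩ := exists_cancel_mul g (FreeGroup.mk L)
  rw [toWord_mk_of_isReduced hL] at h2
  subst h2
  have hQ : Q = [] := by
    cases Q with
    | nil => rfl
    | cons q Q =>
      simp only [hd, h1, h3, List.cons_append, List.head?_cons, Option.some.injEq] at hi hj
      exact absurd (hi.symm.trans hj) hij
  subst hQ
  have hg : g = (FreeGroup.mk P)⁻¹ := by
    rw [inv_mk, ← mk_toWord (x := g), h1, List.nil_append]
  have hP : P ≠ [] := by
    rintro rfl
    simp [hd, h1] at hi
  have hk : P.length - 1 + 1 = P.length := by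
    have := List.length_pos_iff.2 hP
    omega
  have hg' : prefixInv (P ++ S) (P.length - 1) = g := by
    rw [prefixInv, hk, hg, List.take_left]
  have hlt : P.length - 1 < (P ++ S).length := by
    rw [List.length_append]
    omega
  refine ⟨_, hlt, ?_, ?_, hg'⟩
  · have := hd_prefixInv hL hlt
    rw [hg', hi] at this
    simp [List.getElem?_eq_getElem hlt, Option.some.inj this]
  · rw [← hd_prefixInv_mul hL, hg', hj]

lemma turn_mk {L : List (X × Bool)} (hL : IsReduced L) {i j : X × Bool} (hij : i ≠ j) :
    turn (FreeGroup.mk L) i j = pairCount (bar i) j L + pairCount (bar j) i L := by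
  rw [pairCount_eq_card, pairCount_eq_card, ← Finset.card_union_of_disjoint]
  swap
  · rw [Finset.disjoint_filter]
    rintro k - h1 h2
    exact hij (bar_injective (Option.some.inj (h1.1.symm.trans h2.1)))
  rw [← Finset.filter_or, ← Finset.card_image_of_injOn ((prefixInv_injOn hL).mono fun k hk => ?_), turn,
    ← Set.ncard_coe_finset]
  swap
  · exact Finset.filter_subset _ _ hk
  congr 1
  ext g
  simp only [crossing, Finset.mem_singleton, exists_eq_left, Finset.coe_image, Finset.coe_filter,
    Finset.mem_range, Set.mem_image, Set.mem_ofPred_eq]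
  constructor
  · rintro (⟨h1, h2⟩ | ⟨h1, h2⟩)
    · obtain ⟨k, hk, h3, h4, h5⟩ := exists_prefixInv hL hij h1 h2
      exact ⟨k, ⟨hk, Or.inl ⟨h3, h4⟩⟩, h5⟩
    · obtain ⟨k, hk, h3, h4, h5⟩ := exists_prefixInv hL hij.symm h1 h2
      exact ⟨k, ⟨hk, Or.inr ⟨h3, h4⟩⟩, h5⟩
  · rintro ⟨k, ⟨hk, ⟨h1, h2⟩ | ⟨h1, h2⟩⟩, rfl⟩ <;>
    rw [List.getElem?_eq_getElem hk, Option.some.injEq] at h1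
    · left
      rw [hd_prefixInv hL hk, hd_prefixInv_mul hL, h1, h2]
      simp
    · right
      rw [hd_prefixInv hL hk, hd_prefixInv_mul hL, h1, h2]
      simp

lemma balanced_mk [Fintype X] {L : List (X × Bool)} (hL : IsCyclicallyReduced L) {l h : ℝ}
    (hl : 0 < l) (hlh : 2 * Fintype.card X * (h + 1) < (2 * Fintype.card X + 1) * l)
    (H : ∀ a b, b ≠ bar a → l ≤ pairCount a b L ∧ pairCount a b L ≤ h) :
    Balanced (FreeGroup.mk L) := by
  refine ⟨2 * l, 2 * (h + 1), by linarith, by linarith, fun m hm i j hij => ?_⟩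
  rw [pow_mk, turn_mk (hL.flatten_replicate m).isReduced hij]
  have key : ∀ a b, b ≠ bar a → m * l ≤ pairCount a b (List.replicate m L).flatten ∧
      pairCount a b (List.replicate m L).flatten ≤ m * (h + 1) := by
    intro a b hab
    obtain ⟨h1, h2⟩ := H a b hab
    have h3 : (m * pairCount a b L : ℝ) ≤ pairCount a b (List.replicate m L).flatten := by
      exact_mod_cast le_pairCount_flatten_replicate a b L m
    have h4 : (pairCount a b (List.replicate m L).flatten : ℝ) ≤ m * (pairCount a b L + 1) := by
      exact_mod_cast pairCount_flatten_replicate_le a b L m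
    exact ⟨le_trans (by gcongr) h3, h4.trans (by gcongr)⟩
  obtain ⟨h1, h2⟩ := key (bar i) j (by simpa using hij.symm)
  obtain ⟨h3, h4⟩ := key (bar j) i (by simpa using hij)
  push_cast
  constructor <;> linarith

/-- If all two-letter words occur with nearly equal frequencies in `w`, and `w` is nearly
cyclically reduced, then the stabilizer of `w` is infinite cyclic. -/
theorem nonempty_stabilizer_mulEquiv_of_pairCount [Fintype X] (hX : 2 ≤ Fintype.card X)
    (w : FreeGroup X) {l h k : ℝ} (hl : 0 < l - 2 * k - 2)
    (hlh : 2 * Fintype.card X * (h + 1) < (2 * Fintype.card X + 1) * (l - 2 * k - 2))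
    (hG : ∀ G V, w.toWord = G ++ V ++ invRev G → G.length ≤ k)
    (H : ∀ a b, b ≠ bar a → l ≤ pairCount a b w.toWord ∧ pairCount a b w.toWord ≤ h) :
    Nonempty (MulAction.stabilizer (MulAut (FreeGroup X)) w ≃* Multiplicative ℤ) := by
  set G := reduceCyclically.conjugator w.toWord
  set L := reduceCyclically w.toWord
  have hw : G ++ L ++ invRev G = w.toWord :=
    reduceCyclically.conj_conjugator_reduceCyclically w.toWord
  have hL : IsCyclicallyReduced L := reduceCyclically.isCyclicallyReduced isReduced_toWord
  have hk := hG G L hw.symm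
  have HL : ∀ a b, b ≠ bar a → l - 2 * k - 2 ≤ pairCount a b L ∧ pairCount a b L ≤ h := by
    intro a b hab
    obtain ⟨h1, h2⟩ := H a b hab
    rw [← hw] at h1 h2
    have e1 := le_pairCount_append a b (G ++ L) (invRev G)
    have e2 := le_pairCount_append a b G L
    have e3 := pairCount_append_le a b (G ++ L) (invRev G)
    have e4 := pairCount_append_le a b G L
    have e5 := pairCount_le_length a b G
    have e6 := pairCount_le_length a b (invRev G)
    rw [invRev_length] at e6
    have e7 : pairCount a b L ≤ pairCount a b (G ++ L ++ invRev G) := by omega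
    have e8 : pairCount a b (G ++ L ++ invRev G) ≤ 2 * G.length + pairCount a b L + 2 := by omega
    have e7' : (pairCount a b L : ℝ) ≤ pairCount a b (G ++ L ++ invRev G) := by exact_mod_cast e7
    have e8' : (pairCount a b (G ++ L ++ invRev G) : ℝ) ≤
      2 * G.length + pairCount a b L + 2 := by exact_mod_cast e8
    constructor <;> linarith
  have hmem : ∀ a, a ∈ L := by
    intro a
    have h1 := (HL a a (bar_ne a).symm).1
    have : (0 : ℝ) < pairCount a a L := by linarith
    exact mem_of_pairCount_pos (b := a) (by exact_mod_cast this)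
  obtain ⟨x⟩ : Nonempty X := Fintype.card_pos_iff.1 (by omega)
  obtain ⟨a, p, hA, ha⟩ := exists_isAxis hL (List.ne_nil_of_mem (hmem (x, true)))
  have hb := balanced_mk hL hl hlh HL
  obtain ⟨e⟩ := hA.nonempty_stabilizer_mulEquiv hX (fun x => by
    obtain ⟨i, hi⟩ := ha _ (hmem (x, true))
    exact ⟨i, by rw [hi]⟩) fun φ hφ => hb.exists_mapsVertex hX hφ
  refine ⟨(MulAction.stabilizerEquivStabilizer
    (g := (MulAut.conj (FreeGroup.mk G))⁻¹) ?_).trans e⟩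
  rw [eq_inv_smul_iff, MulAut.smul_def, MulAut.conj_apply, inv_mk, mul_mk, mul_mk, hw, mk_toWord]

end Turns

section Counting

variable {X : Type} [Fintype X] [DecidableEq X]

/-- The letters that may follow `x` in a reduced word. -/
def successors (x : X × Bool) : Finset (X × Bool) := Finset.univ.filter (· ≠ bar x)

@[simp] lemma mem_successors {x y : X × Bool} : y ∈ successors x ↔ y ≠ bar x := by
  simp [successors]

lemma successors_eq_erase (x : X × Bool) : successors x = Finset.univ.erase (bar x) := by
  ext y
  simp

lemma card_successors (x : X × Bool) : (successors x).card = 2 * Fintype.card X - 1 := by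
  rw [successors_eq_erase, Finset.card_erase_of_mem (Finset.mem_univ _), Finset.card_univ,
    card_letters]

/-- The reduced words of length `n + 1` starting with `x`. -/
def words : ℕ → X × Bool → Finset (List (X × Bool))
  | 0, x => {[x]}
  | n + 1, x => (successors x).biUnion fun y => (words n y).image (x :: ·)

lemma mem_words {n : ℕ} {x : X × Bool} {L : List (X × Bool)} :
    L ∈ words n x ↔ IsReduced L ∧ L.length = n + 1 ∧ L.head? = some x := by
  induction n generalizing x L with
  | zero =>
    rw [words, Finset.mem_singleton]
    constructor
    · rintro rfl
      simp [FreeGroup.IsReduced]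
    · rintro ⟨-, h1, h2⟩
      obtain ⟨y, rfl⟩ := List.length_eq_one_iff.1 (by simpa using h1)
      simpa using h2
  | succ n ih =>
    simp only [words, Finset.mem_biUnion, mem_successors, Finset.mem_image, ih]
    constructor
    · rintro ⟨y, hy, L, ⟨h1, h2, h3⟩, rfl⟩
      obtain ⟨T, rfl⟩ : ∃ T, L = y :: T := List.head?_eq_some_iff.1 h3
      exact ⟨isReduced_cons_cons.2 ⟨hy, h1⟩, by simpa using h2, rfl⟩
    · rintro ⟨h1, h2, h3⟩
      obtain ⟨T, rfl⟩ := List.head?_eq_some_iff.1 h3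
      cases T with
      | nil => simp at h2
      | cons y T =>
        rw [isReduced_cons_cons] at h1
        exact ⟨y, h1.1, _, ⟨h1.2, by simpa using h2, rfl⟩, rfl⟩

lemma sum_words_succ {M : Type*} [AddCommMonoid M] (n : ℕ) (x : X × Bool)
    (f : List (X × Bool) → M) :
    ∑ L ∈ words (n + 1) x, f L = ∑ y ∈ successors x, ∑ L ∈ words n y, f (x :: L) := by
  rw [words, Finset.sum_biUnion]
  · refine Finset.sum_congr rfl fun y _ => ?_
    rw [Finset.sum_image fun _ _ _ _ h => (List.cons.inj h).2]
  · intro y _ z _ hyz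
    rw [Function.onFun, Finset.disjoint_left]
    rintro L h1 h2
    obtain ⟨L1, hL1, rfl⟩ := Finset.mem_image.1 h1
    obtain ⟨L2, hL2, h⟩ := Finset.mem_image.1 h2
    obtain rfl := (List.cons.inj h).2
    exact hyz (Option.some.inj ((mem_words.1 hL1).2.2.symm.trans (mem_words.1 hL2).2.2))

lemma card_words (n : ℕ) (x : X × Bool) : (words n x).card = (2 * Fintype.card X - 1) ^ n := by
  induction n generalizing x with
  | zero => simp [words]
  | succ n ih =>
    rw [Finset.card_eq_sum_ones, sum_words_succ]
    simp only [← Finset.card_eq_sum_ones, ih]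
    rw [Finset.sum_const, card_successors, smul_eq_mul, pow_succ']

/-- The number of reduced words of length `n + 1` with property `P`. -/
noncomputable def countWords (P : List (X × Bool) → Prop) (n : ℕ) : ℕ := by
  classical exact ∑ x, ((words n x).filter P).card

open Classical in
lemma countWords_eq (P : List (X × Bool) → Prop) (n : ℕ) :
    countWords P n = ∑ x, ((words n x).filter P).card := by
  rw [countWords]

/-- Among reduced words, those with property `P` have a smaller exponential growth rate. -/
def Rare (P : List (X × Bool) → Prop) : Prop :=
  ∃ r : ℝ, 0 < r ∧ r < 2 * Fintype.card X - 1 ∧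
    (fun n => (countWords P n : ℝ)) =O[atTop] fun n => r ^ n

lemma isBigO_pow_of_le {f : ℕ → ℝ} {r s : ℝ} (h : f =O[atTop] fun n => r ^ n) (hr : 0 < r)
    (hrs : r ≤ s) : f =O[atTop] fun n => s ^ n := by
  refine h.trans (Asymptotics.IsBigO.of_bound 1 (Eventually.of_forall fun n => ?_))
  rw [Real.norm_of_nonneg (by positivity), Real.norm_of_nonneg (pow_nonneg (hr.le.trans hrs) _),
    one_mul]
  gcongr

lemma Rare.mono {P Q : List (X × Bool) → Prop} {m : ℕ} (hQ : Rare Q)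
    (h : ∀ L, IsReduced L → m ≤ L.length → P L → Q L) : Rare P := by
  classical
  obtain ⟨r, hr, hr', hO⟩ := hQ
  refine ⟨r, hr, hr', Asymptotics.IsBigO.trans (Asymptotics.IsBigO.of_bound 1 ?_) hO⟩
  filter_upwards [eventually_ge_atTop m] with n hn
  rw [one_mul, Real.norm_natCast, Real.norm_natCast, Nat.cast_le, countWords_eq, countWords_eq]
  refine Finset.sum_le_sum fun x _ => Finset.card_le_card fun L hL => ?_
  rw [Finset.mem_filter] at hL ⊢
  obtain ⟨h1, h2, -⟩ := mem_words.1 hL.1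
  exact ⟨hL.1, h L h1 (by omega) hL.2⟩

lemma Rare.or {P Q : List (X × Bool) → Prop} (hP : Rare P) (hQ : Rare Q) :
    Rare fun L => P L ∨ Q L := by
  classical
  obtain ⟨r, hr, hr', hO⟩ := hP
  obtain ⟨s, hs, hs', hO'⟩ := hQ
  refine ⟨max r s, lt_max_of_lt_left hr, max_lt hr' hs', ?_⟩
  refine Asymptotics.IsBigO.trans (Asymptotics.IsBigO.of_bound 1 (Eventually.of_forall fun n => ?_))
    ((isBigO_pow_of_le hO hr (le_max_left r s)).add (isBigO_pow_of_le hO' hs (le_max_right r s)))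
  rw [one_mul, ← Nat.cast_add, Real.norm_natCast, Real.norm_natCast, Nat.cast_le, countWords_eq,
    countWords_eq, countWords_eq, ← Finset.sum_add_distrib]
  refine Finset.sum_le_sum fun x _ => ?_
  refine (Finset.card_le_card fun L hL => ?_).trans (Finset.card_union_le _ _)
  simpa [← and_or_left] using hL

lemma rare_false (hX : 2 ≤ Fintype.card X) : Rare fun _ : List (X × Bool) => False := by
  have : (2 : ℝ) ≤ Fintype.card X := by exact_mod_cast hX
  refine ⟨1, one_pos, by linarith, ?_⟩
  simpa [countWords_eq] using
    Asymptotics.isBigO_zero (E' := ℝ) (fun n => (1 : ℝ) ^ n) (atTop : Filter ℕ)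

lemma rare_exists (hX : 2 ≤ Fintype.card X) {ι : Type*} [Finite ι]
    {P : ι → List (X × Bool) → Prop} (h : ∀ i, Rare (P i)) : Rare fun L => ∃ i, P i L := by
  classical
  have := Fintype.ofFinite ι
  suffices H : ∀ s : Finset ι, Rare fun L => ∃ i ∈ s, P i L by simpa using H Finset.univ
  intro s
  induction s using Finset.induction_on with
  | empty => simpa using rare_false hX
  | insert i s _ ih => simpa using (h i).or ih

/-- The sum of `κ` over consecutive pairs of letters. -/
def pathSum (κ : X × Bool → X × Bool → ℝ) : List (X × Bool) → ℝ
  | [] => 0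
  | [_] => 0
  | x :: y :: L => κ x y + pathSum κ (y :: L)

lemma pathSum_cons {κ : X × Bool → X × Bool → ℝ} {n : ℕ} {x y : X × Bool} {L : List (X × Bool)}
    (hL : L ∈ words n y) : pathSum κ (x :: L) = κ x y + pathSum κ L := by
  obtain ⟨T, rfl⟩ := List.head?_eq_some_iff.1 (mem_words.1 hL).2.2
  rfl

lemma eventually_sum_exp_lt {ι : Type*} (s : Finset ι) (v : ι → ℝ) (h : ∑ i ∈ s, v i < 0) :
    ∀ᶠ θ in nhdsWithin (0 : ℝ) (Set.Ioi 0), ∑ i ∈ s, Real.exp (θ * v i) < s.card := by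
  have hd : HasDerivAt (fun θ : ℝ => ∑ i ∈ s, Real.exp (θ * v i)) (∑ i ∈ s, v i) 0 := by
    refine HasDerivAt.fun_sum fun i _ => ?_
    have := ((hasDerivAt_id (0 : ℝ)).mul_const (v i)).exp
    simpa using this
  have hs := (hasDerivAt_iff_tendsto_slope.1 hd).mono_left
    (nhdsWithin_mono 0 fun x (hx : 0 < x) => hx.ne')
  filter_upwards [hs.eventually_lt_const h, self_mem_nhdsWithin] with θ hθ hθ0
  have hθ0' : (0 : ℝ) < θ := hθ0
  rw [slope_def_field, sub_zero, div_lt_iff₀ hθ0'] at hθ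
  simpa using hθ

/-- An exponential moment bound: if `κ` has negative mean, up to a coboundary, along every letter,
then it rarely has nonnegative sum along a word. -/
lemma rare_pathSum_nonneg (hX : 2 ≤ Fintype.card X) (κ : X × Bool → X × Bool → ℝ)
    (h : X × Bool → ℝ) (h0 : ∀ x, 0 ≤ h x)
    (hneg : ∀ x, ∑ y ∈ successors x, (κ x y + h y - h x) < 0) :
    Rare fun L => 0 ≤ pathSum κ L := by
  classical
  obtain ⟨x₁⟩ : Nonempty X := Fintype.card_pos_iff.1 (by omega)
  have hne : Nonempty (X × Bool) := ⟨(x₁, true)⟩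
  obtain ⟨θ, hθ, hθ0⟩ : ∃ θ : ℝ, (∀ x, ∑ y ∈ successors x, Real.exp (θ * (κ x y + h y - h x)) <
      (successors x).card) ∧ 0 < θ :=
    ((eventually_all.2 fun x => eventually_sum_exp_lt _ _ (hneg x)).and
      self_mem_nhdsWithin).exists
  obtain ⟨x₀, hx₀⟩ := Finite.exists_max fun x =>
    ∑ y ∈ successors x, Real.exp (θ * (κ x y + h y - h x))
  set Λ := ∑ y ∈ successors x₀, Real.exp (θ * (κ x₀ y + h y - h x₀))
  have hΛ : Λ < 2 * Fintype.card X - 1 := by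
    refine (hθ x₀).trans_eq ?_
    rw [card_successors, Nat.cast_sub (by omega)]
    simp
  have hΛ0 : 0 < Λ := by
    refine Finset.sum_pos (fun y _ => Real.exp_pos _) ⟨x₀, ?_⟩
    rw [mem_successors]
    exact (bar_ne x₀).symm
  have key : ∀ n x, ∑ L ∈ words n x, Real.exp (θ * pathSum κ L) ≤ Λ ^ n * Real.exp (θ * h x) := by
    intro n
    induction n with
    | zero =>
      intro x
      simp only [words, Finset.sum_singleton, pathSum, mul_zero, Real.exp_zero, pow_zero, one_mul]
      exact Real.one_le_exp (mul_nonneg hθ0.le (h0 x))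
    | succ n ih =>
      intro x
      rw [sum_words_succ]
      calc _ = ∑ y ∈ successors x, Real.exp (θ * κ x y) *
            ∑ L ∈ words n y, Real.exp (θ * pathSum κ L) := by
            refine Finset.sum_congr rfl fun y _ => ?_
            rw [Finset.mul_sum]
            refine Finset.sum_congr rfl fun L hL => ?_
            rw [pathSum_cons hL, mul_add, Real.exp_add]
        _ ≤ ∑ y ∈ successors x, Real.exp (θ * κ x y) * (Λ ^ n * Real.exp (θ * h y)) := by
            gcongr with y _
            exact ih y
        _ = Λ ^ n * Real.exp (θ * h x) *
              ∑ y ∈ successors x, Real.exp (θ * (κ x y + h y - h x)) := by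
            rw [Finset.mul_sum]
            refine Finset.sum_congr rfl fun y _ => ?_
            rw [mul_sub, mul_add, Real.exp_sub, Real.exp_add]
            field_simp
        _ ≤ Λ ^ n * Real.exp (θ * h x) * Λ := by
            gcongr
            exact hx₀ x
        _ = _ := by ring
  refine ⟨Λ, hΛ0, hΛ, Asymptotics.IsBigO.of_bound (∑ x, Real.exp (θ * h x))
    (Eventually.of_forall fun n => ?_)⟩
  rw [Real.norm_natCast, Real.norm_of_nonneg (by positivity), countWords_eq, Nat.cast_sum,
    Finset.sum_mul]
  refine Finset.sum_le_sum fun x _ => ?_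
  rw [mul_comm]
  refine le_trans ?_ (key n x)
  rw [Finset.card_filter, Nat.cast_sum]
  refine Finset.sum_le_sum fun L _ => ?_
  split_ifs with hL
  · simpa using Real.one_le_exp (mul_nonneg hθ0.le hL)
  · simpa using (Real.exp_pos _).le

end Counting

section Genericity

variable {X : Type} [DecidableEq X]

lemma pathSum_eq (a b : X × Bool) (σ p ε : ℝ) (x : X × Bool) (L : List (X × Bool)) :
    pathSum (fun x y => σ * ((if x = a ∧ y = b then 1 else 0) - p) - ε) (x :: L) =
      σ * (pairCount a b (x :: L) - p * L.length) - ε * L.length := by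
  induction L generalizing x with
  | nil => simp [pathSum, pairCount]
  | cons y L ih =>
    have h : pairCount a b (x :: y :: L) =
        (if x = a ∧ y = b then 1 else 0) + pairCount a b (y :: L) := by
      rw [pairCount]
      simp
    rw [pathSum, ih, h, List.length_cons]
    push_cast
    ring

variable [Fintype X]

lemma sum_successors (x : X × Bool) (f : X × Bool → ℝ) :
    ∑ y ∈ successors x, f y = ∑ y, f y - f (bar x) := by
  rw [successors_eq_erase, Finset.sum_erase_eq_sub (Finset.mem_univ _)]

/-- Frequencies of two-letter words rarely deviate from their mean. -/
lemma rare_pairCount (hX : 2 ≤ Fintype.card X) {a b : X × Bool} (hab : b ≠ bar a) {σ ε : ℝ}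
    (hσ : |σ| ≤ 1) (hε : 0 < ε) :
    Rare fun L : List (X × Bool) => ε * (L.length - 1 : ℝ) ≤ σ * (pairCount a b L -
      1 / (2 * Fintype.card X * (2 * Fintype.card X - 1) : ℝ) * (L.length - 1 : ℝ)) := by
  have hN : (2 : ℝ) ≤ Fintype.card X := by exact_mod_cast hX
  obtain ⟨q, hq⟩ : ∃ q : ℝ, q = 2 * Fintype.card X - 1 := ⟨_, rfl⟩
  have hq' : (2 * Fintype.card X : ℝ) = q + 1 := by linarith
  have hq3 : 3 ≤ q := by linarith
  rw [← hq, hq']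
  have h1 : (0 : ℝ) < q + 1 := by linarith
  have h2 : (0 : ℝ) < q - 1 := by linarith
  set p := 1 / ((q + 1) * q) with hp
  set α := q / ((q + 1) * (q - 1)) with hα
  set β := 1 / ((q + 1) * (q - 1)) with hβ
  have hα0 : 0 ≤ α := by positivity
  have hβ0 : 0 ≤ β := by positivity
  have hα1 : α ≤ 1 := by
    rw [hα, div_le_one (by positivity)]
    nlinarith
  have hβ1 : β ≤ 1 := by
    rw [hβ, div_le_one (by positivity)]
    nlinarith
  have hab' := bar_ne a
  obtain ⟨hσ1, hσ2⟩ := abs_le.1 hσ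
  have := rare_pathSum_nonneg hX (fun x y => σ * ((if x = a ∧ y = b then 1 else 0) - p) - ε)
    (fun x => 1 + σ * (α * (if x = a then 1 else 0) - β * (if x = bar a then 1 else 0)))
    (fun x => ?_) (fun x => ?_)
  · refine this.mono (m := 1) fun L _ hL h => ?_
    cases L with
    | nil => simp at hL
    | cons x L =>
      rw [pathSum_eq]
      simp only [List.length_cons, Nat.cast_add, Nat.cast_one, add_sub_cancel_right] at h
      linarith
  · by_cases hxa : x = a
    · subst hxa
      simp only [if_true, hab'.symm, if_false]
      nlinarith
    · by_cases hxb : x = bar a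
      · simp only [if_pos hxb, if_neg hxa]
        nlinarith
      · simp only [if_neg hxb, if_neg hxa]
        simp
  · have e1 : ∑ y ∈ successors x, (if x = a ∧ y = b then 1 else 0 : ℝ) = if x = a then 1 else 0 := by
      by_cases hxa : x = a
      · subst hxa
        simp [hab]
      · simp [hxa]
    have e2 : ((successors x).card : ℝ) = q := by
      rw [card_successors, Nat.cast_sub (by omega), hq]
      simp
    have e3 : ∑ y ∈ successors x, (if y = a then 1 else 0 : ℝ) =
        1 - if x = bar a then 1 else 0 := by
      rw [sum_successors]
      simp [bar_eq_iff]
    have e4 : ∑ y ∈ successors x, (if y = bar a then 1 else 0 : ℝ) =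
        1 - if x = a then 1 else 0 := by
      rw [sum_successors]
      simp [bar_injective.eq_iff]
    simp only [Finset.sum_sub_distrib, Finset.sum_add_distrib, ← Finset.mul_sum, Finset.sum_const,
      e1, e2, e3, e4, nsmul_eq_mul]
    have hneg : -(q * ε) < 0 := by
      rw [neg_lt_zero]
      positivity
    refine lt_of_eq_of_lt ?_ hneg
    rw [hp, hα, hβ]
    by_cases hxa : x = a
    · subst hxa
      simp only [if_true, hab'.symm, if_false]
      field_simp
      ring
    · by_cases hxb : x = bar a
      · simp only [if_pos hxb, if_neg hxa]
        field_simp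
        ring
      · simp only [if_neg hxb, if_neg hxa]
        field_simp
        ring

/-- Reduced words are rarely far from being cyclically reduced. -/
lemma rare_conjugator (hX : 2 ≤ Fintype.card X) {ε : ℝ} (hε : 0 < ε) :
    Rare fun L : List (X × Bool) => ∃ G V, L = G ++ V ++ invRev G ∧
      ε * (L.length - 1 : ℝ) < G.length := by
  classical
  have hN : (2 : ℝ) ≤ Fintype.card X := by exact_mod_cast hX
  obtain ⟨q, hq⟩ : ∃ q : ℝ, q = 2 * Fintype.card X - 1 := ⟨_, rfl⟩
  have hq1 : 1 < q := by linarith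
  have hq0 : 0 < q := by linarith
  refine ⟨q ^ (1 - ε), by positivity, ?_, Asymptotics.IsBigO.of_bound
    (Finset.univ : Finset (X × Bool)).card (Eventually.of_forall fun n => ?_)⟩
  · rw [← hq]
    conv_rhs => rw [← Real.rpow_one q]
    exact Real.rpow_lt_rpow_of_exponent_lt hq1 (by linarith)
  rw [Real.norm_natCast, Real.norm_of_nonneg (by positivity), countWords_eq, Nat.cast_sum,
    ← nsmul_eq_mul, ← Finset.sum_const]
  refine Finset.sum_le_sum fun x _ => ?_
  set F := (words n x).filter fun L => ∃ G V, L = G ++ V ++ invRev G ∧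
    ε * (L.length - 1 : ℝ) < G.length with hF
  set k := ⌈ε * n⌉₊ with hk
  have hsplit : ∀ L ∈ F, ∃ A M, L = A ++ M ++ invRev A ∧ A.length = k := by
    intro L hL
    obtain ⟨h1, G, V, rfl, h2⟩ := Finset.mem_filter.1 hL
    rw [(mem_words.1 h1).2.1] at h2
    have hkG : k ≤ G.length := by
      rw [hk, Nat.ceil_le]
      push_cast at h2
      rw [add_sub_cancel_right] at h2
      exact h2.le
    refine ⟨G.take k, G.drop k ++ V ++ invRev (G.drop k), ?_, by simpa using hkG⟩
    have h3 : invRev G = invRev (G.drop k) ++ invRev (G.take k) := by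
      rw [← invRev_append, List.take_append_drop]
    rw [h3]
    conv_lhs => enter [1, 1]; rw [← List.take_append_drop k G]
    simp only [List.append_assoc]
  rcases F.eq_empty_or_nonempty with h0 | ⟨L₀, hL₀⟩
  · rw [h0]
    simp only [Finset.card_empty, Nat.cast_zero]
    positivity
  have hkn : 2 * k ≤ n + 1 := by
    obtain ⟨A, M, hL, hA⟩ := hsplit L₀ hL₀
    have := (mem_words.1 (Finset.mem_filter.1 hL₀).1).2.1
    rw [hL, List.length_append, List.length_append, invRev_length] at this
    omega
  have hcard : F.card ≤ (words (n - k) x).card := by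
    have htake : ∀ L ∈ F, ∃ A M, L = A ++ M ++ invRev A ∧ A.length = k ∧
        L.take (n + 1 - k) = A ++ M := by
      intro L hL
      obtain ⟨A, M, rfl, hA⟩ := hsplit L hL
      have := (mem_words.1 (Finset.mem_filter.1 hL).1).2.1
      rw [List.length_append, invRev_length] at this
      exact ⟨A, M, rfl, hA, List.take_left' (by omega)⟩
    refine Finset.card_le_card_of_injOn (List.take (n + 1 - k)) ?_ ?_
    · intro L hL
      obtain ⟨h1, h2, h3⟩ := mem_words.1 (Finset.mem_filter.1 hL).1
      rw [SetLike.mem_coe, mem_words]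
      refine ⟨h1.infix (L.take_prefix _).isInfix, by rw [List.length_take]; omega, ?_⟩
      rw [List.head?_take, if_neg (by omega), h3]
    · intro L hL L' hL' h
      obtain ⟨A, M, rfl, hA, h1⟩ := htake L hL
      obtain ⟨A', M', rfl, hA', h1'⟩ := htake L' hL'
      rw [h1, h1'] at h
      have hAA : A = A' := List.append_inj_left h (hA.trans hA'.symm)
      rw [h, hAA]
  rw [card_words] at hcard
  calc (F.card : ℝ) ≤ ((2 * Fintype.card X - 1) ^ (n - k) : ℕ) := by exact_mod_cast hcard
    _ = q ^ (n - k) := by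
      rw [Nat.cast_pow, Nat.cast_sub (by omega), hq]
      simp
    _ = q ^ ((n : ℝ) - k) := by
      rw [← Nat.cast_sub (by omega), Real.rpow_natCast]
    _ ≤ q ^ ((1 - ε) * n) := by
      refine Real.rpow_le_rpow_of_exponent_le hq1.le ?_
      have : ε * n ≤ k := Nat.le_ceil _
      linarith
    _ = (q ^ (1 - ε)) ^ n := by
      rw [Real.rpow_mul hq0.le, Real.rpow_natCast]

lemma finite_ballF (n : ℕ) : (ballF X n).Finite :=
  Set.Finite.of_injOn (f := FreeGroup.toWord) (t := {L | L.length ≤ n}) (fun _ h => h)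
    toWord_injective.injOn (List.finite_length_le _ n)

lemma pow_le_ncard_ballF (hX : 2 ≤ Fintype.card X) (n : ℕ) :
    (2 * Fintype.card X - 1) ^ n ≤ (ballF X n).ncard := by
  obtain ⟨x₁⟩ : Nonempty X := Fintype.card_pos_iff.1 (by omega)
  rw [← card_words n (x₁, true), ← Set.ncard_coe_finset]
  have htail : ∀ L ∈ words n (x₁, true), L = (x₁, true) :: L.tail ∧ IsReduced L.tail := by
    intro L hL
    obtain ⟨h1, h2, h3⟩ := mem_words.1 hL
    obtain ⟨T, rfl⟩ := List.head?_eq_some_iff.1 h3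
    exact ⟨rfl, h1.infix ⟨[(x₁, true)], [], by simp⟩⟩
  refine Set.ncard_le_ncard_of_injOn (fun L => FreeGroup.mk L.tail) (fun L hL => ?_)
    (fun L hL L' hL' h => ?_) (finite_ballF n)
  · have := (mem_words.1 hL).2.1
    refine norm_mk_le.trans ?_
    rw [List.length_tail]
    omega
  · have := congrArg FreeGroup.toWord h
    simp only at this
    rw [toWord_mk_of_isReduced (htail L hL).2, toWord_mk_of_isReduced (htail L' hL').2] at this
    rw [(htail L hL).1, (htail L' hL').1, this]

lemma ncard_inter_ballF_le (P : List (X × Bool) → Prop) (n : ℕ) :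
    ({w : FreeGroup X | P w.toWord} ∩ ballF X n).ncard ≤
      1 + ∑ m ∈ Finset.range n, countWords P m := by
  classical
  set T : Finset (List (X × Bool)) := {[]} ∪ (Finset.range n).biUnion fun m =>
    Finset.univ.biUnion fun x => (words m x).filter P with hT
  have h1 : ({w : FreeGroup X | P w.toWord} ∩ ballF X n).ncard ≤ (T : Set (List (X × Bool))).ncard := by
    refine Set.ncard_le_ncard_of_injOn FreeGroup.toWord (fun w hw => ?_) toWord_injective.injOn
      T.finite_toSet
    have hP : P w.toWord := hw.1
    have hn : w.toWord.length ≤ n := hw.2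
    rw [SetLike.mem_coe, hT, Finset.mem_union, Finset.mem_singleton]
    cases hL : w.toWord with
    | nil => simp
    | cons x L =>
      right
      simp only [Finset.mem_biUnion, Finset.mem_filter, Finset.mem_range, Finset.mem_univ, true_and,
        mem_words]
      rw [hL, List.length_cons] at hn
      exact ⟨L.length, by omega, x, ⟨hL ▸ isReduced_toWord, rfl, rfl⟩, hL ▸ hP⟩
  rw [Set.ncard_coe_finset] at h1
  refine h1.trans ((Finset.card_union_le _ _).trans ?_)
  rw [Finset.card_singleton]
  gcongr
  refine Finset.card_biUnion_le.trans (Finset.sum_le_sum fun m _ => ?_)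
  rw [countWords_eq]
  exact Finset.card_biUnion_le

lemma expGeneric_of_rare (hX : 2 ≤ Fintype.card X) {S : Set (FreeGroup X)}
    (h : Rare fun L : List (X × Bool) => FreeGroup.mk L ∉ S) : ExpGeneric S Set.univ := by
  have hN : (2 : ℝ) ≤ Fintype.card X := by exact_mod_cast hX
  obtain ⟨q, hq⟩ : ∃ q : ℝ, q = 2 * Fintype.card X - 1 := ⟨_, rfl⟩
  obtain ⟨r₀, hr₀, hr₀', hO⟩ := h
  obtain ⟨r, hr⟩ : ∃ r, r = max r₀ 2 := ⟨_, rfl⟩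
  have hr2 : 2 ≤ r := hr ▸ le_max_right _ _
  have hrq : r < q := by
    rw [hr, max_lt_iff, hq]
    exact ⟨hr₀', by linarith⟩
  obtain ⟨C, hC, hbound⟩ := Asymptotics.bound_of_isBigO_nat_atTop
    (isBigO_pow_of_le hO hr₀ (hr ▸ le_max_left r₀ 2))
  have hq0 : 0 < q := by linarith
  refine ⟨1 + C, by linarith, r / q, by positivity, (div_lt_one hq0).2 hrq, fun n => ?_⟩
  have h1 : ((Set.univ \ S) ∩ ballF X n : Set (FreeGroup X)) =
      {w : FreeGroup X | FreeGroup.mk w.toWord ∉ S} ∩ ballF X n := by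
    ext w
    simp [mk_toWord]
  rw [h1, Set.univ_inter]
  have h2 := ncard_inter_ballF_le (fun L : List (X × Bool) => FreeGroup.mk L ∉ S) n
  have hgeom : ∑ m ∈ Finset.range n, r ^ m ≤ r ^ n := by
    rw [geom_sum_eq (by linarith), div_le_iff₀ (by linarith)]
    nlinarith [pow_pos (show 0 < r by linarith) n]
  have h3 : ∑ m ∈ Finset.range n,
      (countWords (fun L : List (X × Bool) => FreeGroup.mk L ∉ S) m : ℝ) ≤ C * r ^ n := by
    calc _ ≤ ∑ m ∈ Finset.range n, C * r ^ m := by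
          refine Finset.sum_le_sum fun m _ => ?_
          have := hbound (x := m) (by positivity)
          rwa [Real.norm_natCast, Real.norm_of_nonneg (by positivity)] at this
      _ ≤ C * r ^ n := by
          rw [← Finset.mul_sum]
          gcongr
  have h4 : q ^ n ≤ (ballF X n).ncard := by
    have : (((2 * Fintype.card X - 1) ^ n : ℕ) : ℝ) ≤ (ballF X n).ncard := by
      exact_mod_cast pow_le_ncard_ballF hX n
    rw [Nat.cast_pow, Nat.cast_sub (by omega)] at this
    simpa [hq] using this
  have h5 : (1 : ℝ) ≤ r ^ n := one_le_pow₀ (by linarith)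
  calc _ ≤ ((1 + ∑ m ∈ Finset.range n,
          countWords (fun L : List (X × Bool) => FreeGroup.mk L ∉ S) m : ℕ) : ℝ) := by
        exact_mod_cast h2
    _ ≤ (1 + C) * r ^ n := by
        push_cast
        linarith
    _ = (1 + C) * (r / q) ^ n * q ^ n := by
        rw [mul_assoc, ← mul_pow, div_mul_cancel₀ _ hq0.ne']
    _ ≤ _ := by gcongr

lemma rare_stabilizer (hX : 2 ≤ Fintype.card X) :
    Rare fun L : List (X × Bool) => FreeGroup.mk L ∉ {w : FreeGroup X |
      Nonempty ((MulAction.stabilizer (MulAut (FreeGroup X)) w) ≃* Multiplicative ℤ)} := by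
  have hN : (2 : ℝ) ≤ Fintype.card X := by exact_mod_cast hX
  obtain ⟨q, hq⟩ : ∃ q : ℝ, q = 2 * Fintype.card X - 1 := ⟨_, rfl⟩
  have hq' : (2 * Fintype.card X : ℝ) = q + 1 := by linarith
  have hq3 : 3 ≤ q := by linarith
  obtain ⟨p, hp⟩ : ∃ p : ℝ, p = 1 / ((q + 1) * q) := ⟨_, rfl⟩
  have hp0 : 0 < p := by
    rw [hp]
    positivity
  obtain ⟨ε, hε⟩ : ∃ ε : ℝ, ε = p / (2 * (4 * q + 7)) := ⟨_, rfl⟩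
  have hε0 : 0 < ε := by
    rw [hε]
    positivity
  have hεp : ε * (4 * q + 7) = p / 2 := by
    rw [hε]
    field_simp
  obtain ⟨m, hm⟩ := exists_nat_gt ((3 * q + 5) / (p / 2) + 1)
  have hpair := rare_exists hX fun a : X × Bool => rare_exists hX fun b : {b // b ≠ bar a} =>
    (rare_pairCount hX b.2 (σ := 1) (by simp) hε0).or
      (rare_pairCount hX b.2 (σ := -1) (by simp) hε0)
  refine ((rare_conjugator hX hε0).or hpair).mono (m := m) fun L hL hmL h => ?_
  contrapose! h
  obtain ⟨hG, hpc⟩ := h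
  rw [Set.mem_ofPred_eq]
  have hw := toWord_mk_of_isReduced hL
  obtain ⟨t, ht⟩ : ∃ t : ℝ, t = L.length - 1 := ⟨_, rfl⟩
  rw [← ht] at hG
  have hmL' : (m : ℝ) ≤ L.length := by exact_mod_cast hmL
  have htm : 3 * q + 5 < t * (p / 2) := by
    rw [← div_lt_iff₀ (by positivity)]
    linarith
  have hmain : t * (ε * (4 * q + 7)) = t * (p / 2) := by rw [hεp]
  have ht0 : 0 < t := pos_of_mul_pos_left (by linarith : 0 < t * (p / 2)) (by positivity)
  refine nonempty_stabilizer_mulEquiv_of_pairCount hX _ (l := (p - ε) * t) (h := (p + ε) * t)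
    (k := ε * t) ?_ ?_ ?_ ?_
  · have : t * (ε * 3) ≤ t * (ε * (4 * q + 7)) := by
      gcongr
      linarith
    nlinarith
  · rw [hq']
    nlinarith
  · intro G V hGV
    exact hG G V (hw ▸ hGV)
  · intro a b hab
    rw [hw]
    obtain ⟨h1, h2⟩ := hpc a ⟨b, hab⟩
    rw [← ht, hq', show q + 1 - 1 = q by ring, ← hp] at h1 h2
    simp only at h1 h2
    constructor <;> linarith

end Genericity

end GenericStab

/-- the set of elements w ∈ F(X) whose stabilizer in Aut F(X) is infinite
cyclic (isomorphic to ℤ) is exponentially F(X)-generic. -/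
theorem statement7 (X : Type) [Fintype X] [DecidableEq X] (hX : 2 ≤ Fintype.card X) :
    ExpGeneric
      {w : FreeGroup X |
        Nonempty ((MulAction.stabilizer (MulAut (FreeGroup X)) w) ≃* Multiplicative ℤ)}
      (Set.univ : Set (FreeGroup X)) :=
  GenericStab.expGeneric_of_rare hX (GenericStab.rare_stabilizer hX)
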